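/- arXiv:1304.2644 — 6 statements merged into one kernel-verified Lean document; each statement's English description precedes it below -/
import Mathlib

section
/- Let G be the numeration system with coefficients (a_0, a_1, a_2) = (1, 0, 1), i.e., G_0 = 1, G_1 = 2, G_2 = 3 and G_{n+3} = G_{n+2} + G_n for n ≥ 0, and let β be the unique real root greater than 1 of x³ = x² + 1. Then the β-adic van der Corput sequence (φ_β(n))_{n≥1} is uniformly distributed in [0,1). -/
open MeasureTheory Filter

/-- `e` is the greedy `G`-expansion of the positive integer `n`. -/
def IsGExpansion (G : ℕ → ℕ) (n : ℕ) (e : ℕ → ℕ) : Prop :=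
  (∃ K, (∀ k, K ≤ k → e k = 0) ∧ ∑ k ∈ Finset.range K, e k * G k = n) ∧
  (∀ K, 1 ≤ K → ∑ k ∈ Finset.range K, e k * G k < G K)

/-- The `β`-adic Monna map applied to a digit sequence: `∑ k, e k / β^(k+1)`. -/
noncomputable def monna (β : ℝ) (e : ℕ → ℕ) : ℝ := ∑' k, (e k : ℝ) / β ^ (k + 1)

/-- A sequence `(x n)_{n ≥ 1}` is uniformly distributed in `[0,1)`. -/
def IsUDOne (x : ℕ → ℝ) : Prop :=
  ∀ a b : ℝ, 0 ≤ a → a ≤ b → b ≤ 1 →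
    Tendsto (fun N : ℕ =>
        (∑ n ∈ Finset.Icc 1 N, Set.indicator (Set.Ico a b) (fun _ => (1 : ℝ)) (x n)) / (N : ℝ))
      atTop (nhds (b - a))

/-- Digit sequences with values in `{0, 1}` in which any two ones are at least three places apart. -/
def SparseDigits (e : ℕ → ℕ) : Prop :=
  ∀ k, e k ≤ 1 ∧ (e k = 1 → e (k + 1) = 0 ∧ e (k + 2) = 0)

/-- `e` is a sparse digit sequence of value `n` in the numeration system `G`. -/
structure SparseExpansion (G : ℕ → ℕ) (n : ℕ) (e : ℕ → ℕ) : Prop where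
  sparse : SparseDigits e
  eq_zero : ∀ k, n ≤ k → e k = 0
  sum_eq : ∑ k ∈ Finset.range n, e k * G k = n

/-- The numeration system with coefficients `(1, 0, 1)`. -/
def IsBase101 (G : ℕ → ℕ) : Prop :=
  G 0 = 1 ∧ G 1 = 2 ∧ G 2 = 3 ∧ ∀ n, G (n + 3) = G (n + 2) + G n

/-- The digit sequence `e` preceded by the digit `a`. -/
def consDigit (a : ℕ) (e : ℕ → ℕ) : ℕ → ℕ
  | 0 => a
  | k + 1 => e k

lemma sum_range_eq_of_eq_zero {M : Type*} [NonAssocSemiring M] {e : ℕ → M} {K L : ℕ}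
    (h : ∀ k, K ≤ k → e k = 0) (hKL : K ≤ L) (g : ℕ → M) :
    ∑ k ∈ Finset.range L, e k * g k = ∑ k ∈ Finset.range K, e k * g k := by
  symm
  apply Finset.sum_subset (Finset.range_mono hKL)
  intro k _ hk
  rw [h k (by simpa using hk), zero_mul]

namespace SparseDigits

lemma tail {e : ℕ → ℕ} (h : SparseDigits e) : SparseDigits (fun k => e (k + 1)) :=
  fun k => h (k + 1)

lemma cons_zero {e : ℕ → ℕ} (h : SparseDigits e) : SparseDigits (consDigit 0 e) := by
  rintro (_ | k)
  · simp [consDigit]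
  · exact h k

lemma cons_one {e : ℕ → ℕ} (h : SparseDigits e) :
    SparseDigits (consDigit 1 (consDigit 0 (consDigit 0 e))) := by
  rintro (_ | k)
  · simp [consDigit]
  · exact h.cons_zero.cons_zero k

end SparseDigits

namespace IsBase101

variable {G : ℕ → ℕ}

lemma strictMono (hG : IsBase101 G) : StrictMono G := by
  obtain ⟨h0, h1, h2, h⟩ := hG
  have aux : ∀ n, 0 < G n ∧ 0 < G (n + 1) ∧ 0 < G (n + 2) := by
    intro n
    induction n with
    | zero => simp [h0, h1, h2]
    | succ n ih => exact ⟨ih.2.1, ih.2.2, by rw [show n + 1 + 2 = n + 3 from rfl, h]; omega⟩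
  refine strictMono_nat_of_lt_succ fun n => ?_
  match n with
  | 0 => simp [h0, h1]
  | 1 => simp [h1, h2]
  | n + 2 =>
    have := (aux n).1
    change G (n + 2) < G (n + 3)
    rw [h]
    omega

lemma lt_apply (hG : IsBase101 G) (k : ℕ) : k < G k := by
  induction k with
  | zero => simp [hG.1]
  | succ k ih =>
    have : G k < G (k + 1) := hG.strictMono (Nat.lt_succ_self k)
    omega

lemma apply_succ_le (hG : IsBase101 G) (k : ℕ) : G (k + 1) ≤ 2 * G k := by
  have mono := hG.strictMono.monotone
  obtain ⟨h0, h1, h2, h⟩ := hG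
  match k with
  | 0 => simp [h0, h1]
  | 1 => simp [h1, h2]
  | k + 2 =>
    have := mono (show k ≤ k + 2 by omega)
    change G (k + 3) ≤ 2 * G (k + 2)
    rw [h]
    omega

lemma sum_lt (hG : IsBase101 G) {e : ℕ → ℕ} (he : SparseDigits e) (j K : ℕ) :
    ∑ k ∈ Finset.range K, e k * G (k + j) < G (K + j) := by
  have mono := hG.strictMono
  have pos := hG.lt_apply
  obtain ⟨h0, h1, h2, h⟩ := hG
  induction K using Nat.strong_induction_on with
  | _ K ih =>
    have digit : ∀ k, e k = 0 ∨ e k = 1 := fun k => by have := (he k).1; omega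
    match K with
    | 0 => simpa using Nat.zero_lt_of_lt (pos j)
    | 1 =>
      have := pos j
      have := mono (show j < 1 + j by omega)
      rcases digit 0 with h | h <;> simp [h] <;> omega
    | 2 =>
      have := pos j
      have m1 := mono (show 0 + j < 1 + j by omega)
      have m2 := mono (show 1 + j < 2 + j by omega)
      have h01 := (he 0).2
      rw [Finset.sum_range_succ, Finset.sum_range_one]
      rcases digit 0 with h | h <;> rcases digit 1 with h' | h' <;> simp [h, h'] at * <;> omega
    | K + 3 =>
      have hr := h (K + j)
      rw [show K + j + 3 = K + 3 + j by ring, show K + j + 2 = K + 2 + j by ring] at hr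
      rcases digit (K + 2) with hd | hd
      · rw [Finset.sum_range_succ, hd, zero_mul]
        have := ih (K + 2) (by omega)
        omega
      · have hK : e K = 0 := by
          rcases digit K with h | h
          · exact h
          · have := ((he K).2 h).2; omega
        have hK1 : e (K + 1) = 0 := by
          rcases digit (K + 1) with h | h
          · exact h
          · have : e (K + 2) = 0 := ((he (K + 1)).2 h).1; omega
        rw [Finset.sum_range_succ, Finset.sum_range_succ, Finset.sum_range_succ, hd, hK, hK1]
        have := ih K (by omega)
        omega

lemma sum_lt_sum (hG : IsBase101 G) {e f : ℕ → ℕ} (he : SparseDigits e) (hf : SparseDigits f)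
    (j : ℕ) {K : ℕ}
    (h : ∑ k ∈ Finset.range K, e k * G k < ∑ k ∈ Finset.range K, f k * G k) :
    ∑ k ∈ Finset.range K, e k * G (k + j) < ∑ k ∈ Finset.range K, f k * G (k + j) := by
  induction K with
  | zero => simp at h
  | succ K ih =>
    simp only [Finset.sum_range_succ] at h ⊢
    have h1 := (he K).1
    have h2 := (hf K).1
    have h3 := hG.sum_lt hf 0 K
    have h4 := hG.sum_lt he j K
    simp only [add_zero] at h3
    obtain h1 | h1 : e K = 0 ∨ e K = 1 := by omega
    all_goals obtain h2 | h2 : f K = 0 ∨ f K = 1 := by omega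
    all_goals simp only [h1, h2, zero_mul, one_mul, add_zero] at h ⊢
    all_goals omega

lemma digits_eq (hG : IsBase101 G) {e f : ℕ → ℕ} (he : SparseDigits e) (hf : SparseDigits f)
    {K : ℕ} (h : ∑ k ∈ Finset.range K, e k * G k = ∑ k ∈ Finset.range K, f k * G k) :
    ∀ k < K, e k = f k := by
  induction K with
  | zero => simp
  | succ K ih =>
    simp only [Finset.sum_range_succ] at h
    have h1 := (he K).1
    have h2 := (hf K).1
    have h3 := hG.sum_lt hf 0 K
    have h4 := hG.sum_lt he 0 K
    simp only [add_zero] at h3 h4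
    have hK : e K = f K := by
      obtain h1 | h1 : e K = 0 ∨ e K = 1 := by omega
      all_goals obtain h2 | h2 : f K = 0 ∨ f K = 1 := by omega
      all_goals simp only [h1, h2, zero_mul, one_mul, add_zero] at h ⊢
      all_goals omega
    rw [hK] at h
    intro k hk
    rcases Nat.lt_succ_iff_lt_or_eq.1 hk with hk | rfl
    · exact ih (by omega) k hk
    · exact hK

lemma sparseExpansion (hG : IsBase101 G) {e : ℕ → ℕ} (he : SparseDigits e) {K n : ℕ}
    (hz : ∀ k, K ≤ k → e k = 0) (hs : ∑ k ∈ Finset.range K, e k * G k = n) :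
    SparseExpansion G n e := by
  have hn : ∀ k, n ≤ k → e k = 0 := by
    intro k hk
    by_contra hne
    have hkK : k < K := by
      by_contra hc
      exact hne (hz k (by omega))
    have h1 := Finset.single_le_sum (f := fun k => e k * G k) (fun i _ => Nat.zero_le _)
      (Finset.mem_range.2 hkK)
    have h2 := Nat.le_mul_of_pos_left (G k) (Nat.pos_of_ne_zero hne)
    have h3 := hG.lt_apply k
    omega
  refine ⟨he, hn, ?_⟩
  rw [← sum_range_eq_of_eq_zero (L := max K n) hn (le_max_right _ _),
    sum_range_eq_of_eq_zero hz (le_max_left _ _), hs]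

lemma sparseExpansion_of_isGExpansion (hG : IsBase101 G) {n : ℕ} {e : ℕ → ℕ}
    (h : IsGExpansion G n e) : SparseExpansion G n e := by
  obtain ⟨⟨K, hz, hs⟩, hlt⟩ := h
  have one : ∀ k, e k ≤ 1 := by
    intro k
    have h1 := hlt (k + 1) (by omega)
    have h2 := hG.apply_succ_le k
    rw [Finset.sum_range_succ] at h1
    have h3 : e k * G k < 2 * G k := by omega
    have := Nat.lt_of_mul_lt_mul_right h3
    omega
  have gap : ∀ k, e (k + 2) = 1 → e k = 0 ∧ e (k + 1) = 0 := by
    intro k hk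
    have h1 := hlt (k + 3) (by omega)
    have h2 := hG.2.2.2 k
    have h3 := hG.strictMono (Nat.lt_succ_self k)
    rw [Finset.sum_range_succ, Finset.sum_range_succ, Finset.sum_range_succ, hk] at h1
    constructor
    · by_contra hne
      have := Nat.le_mul_of_pos_left (G k) (Nat.pos_of_ne_zero hne)
      omega
    · by_contra hne
      have := Nat.le_mul_of_pos_left (G (k + 1)) (Nat.pos_of_ne_zero hne)
      simp only [Nat.succ_eq_add_one] at h3
      omega
  refine hG.sparseExpansion (fun k => ⟨one k, fun hk => ⟨?_, ?_⟩⟩) hz hs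
  · have := one (k + 1)
    by_contra hne
    match k with
    | 0 =>
      have h1 := hlt 2 (by omega)
      have h01 : e 1 = 1 := by simp only [zero_add] at *; omega
      simp only [Finset.sum_range_succ, Finset.sum_range_zero, hG.1, hG.2.1, hG.2.2.1, hk, h01]
        at h1
      omega
    | k + 1 =>
      have h1 : e (k + 2) = 1 := by change e (k + 1 + 1) = 1; omega
      have h2 : e (k + 1) = 0 := (gap k h1).2
      omega
  · have := one (k + 2)
    by_contra hne
    have := (gap k (by omega)).1
    omega

end IsBase101

namespace SparseExpansion

variable {G : ℕ → ℕ}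

lemma sum_range {n : ℕ} {e : ℕ → ℕ} (h : SparseExpansion G n e) {K : ℕ} (hK : n ≤ K) :
    ∑ k ∈ Finset.range K, e k * G k = n := by
  rw [sum_range_eq_of_eq_zero h.eq_zero hK, h.sum_eq]

lemma unique (hG : IsBase101 G) {n : ℕ} {e f : ℕ → ℕ} (he : SparseExpansion G n e)
    (hf : SparseExpansion G n f) : e = f := by
  funext k
  rcases lt_or_ge k n with hk | hk
  · exact hG.digits_eq he.sparse hf.sparse (he.sum_eq.trans hf.sum_eq.symm) k hk
  · rw [he.eq_zero k hk, hf.eq_zero k hk]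

lemma zero : SparseExpansion G 0 (fun _ => 0) := ⟨by simp [SparseDigits], by simp, by simp⟩

lemma sum_shift_lt (hG : IsBase101 G) {m n : ℕ} {e f : ℕ → ℕ} (he : SparseExpansion G m e)
    (hf : SparseExpansion G n f) (h : m < n) (j : ℕ) :
    ∑ k ∈ Finset.range m, e k * G (k + j) < ∑ k ∈ Finset.range n, f k * G (k + j) := by
  rw [← sum_range_eq_of_eq_zero he.eq_zero h.le (fun k => G (k + j))]
  exact hG.sum_lt_sum he.sparse hf.sparse j (by rw [he.sum_range h.le, hf.sum_eq]; exact h)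

lemma cons_zero (hG : IsBase101 G) {n : ℕ} {e : ℕ → ℕ} (he : SparseExpansion G n e) :
    SparseExpansion G (∑ k ∈ Finset.range n, e k * G (k + 1)) (consDigit 0 e) := by
  refine hG.sparseExpansion (K := n + 1) he.sparse.cons_zero ?_ ?_
  · rintro (_ | k) hk
    · rfl
    · exact he.eq_zero k (by omega)
  · simp [Finset.sum_range_succ', consDigit]

lemma cons_one (hG : IsBase101 G) {n : ℕ} {e : ℕ → ℕ} (he : SparseExpansion G n e) :
    SparseExpansion G (1 + ∑ k ∈ Finset.range n, e k * G (k + 3))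
      (consDigit 1 (consDigit 0 (consDigit 0 e))) := by
  refine hG.sparseExpansion (K := n + 3) he.sparse.cons_one ?_ ?_
  · rintro (_ | _ | _ | k) hk
    · omega
    · rfl
    · rfl
    · exact he.eq_zero k (by omega)
  · simp [Finset.sum_range_succ', consDigit, hG.1, add_assoc]
    exact add_comm _ _

lemma tail (hG : IsBase101 G) {n : ℕ} {e : ℕ → ℕ} (he : SparseExpansion G n e) :
    SparseExpansion G (∑ k ∈ Finset.range n, e (k + 1) * G k) (fun k => e (k + 1)) :=
  hG.sparseExpansion he.sparse.tail (fun k hk => he.eq_zero (k + 1) (by omega)) rfl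

lemma summable {n : ℕ} {e : ℕ → ℕ} (he : SparseExpansion G n e) (β : ℝ) :
    Summable (fun k => (e k : ℝ) / β ^ (k + 1)) := by
  apply summable_of_ne_finset_zero (s := Finset.range n)
  intro k hk
  simp [he.eq_zero k (by simpa using hk)]

end SparseExpansion

lemma summable_consDigit {β : ℝ} (a : ℕ) {e : ℕ → ℕ}
    (h : Summable (fun k => (e k : ℝ) / β ^ (k + 1))) :
    Summable (fun k => (consDigit a e k : ℝ) / β ^ (k + 1)) := by
  rw [← summable_nat_add_iff 1]
  refine (h.div_const β).congr fun k => ?_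
  rw [div_div, ← pow_succ]
  rfl

lemma monna_consDigit {β : ℝ} (a : ℕ) {e : ℕ → ℕ}
    (h : Summable (fun k => (e k : ℝ) / β ^ (k + 1))) :
    monna β (consDigit a e) = a / β + monna β e / β := by
  unfold monna
  rw [(summable_consDigit a h).tsum_eq_zero_add, ← tsum_div_const]
  congr 1
  · simp [consDigit]
  · refine tsum_congr fun k => ?_
    rw [div_div, ← pow_succ]
    rfl

/-- The ratio of consecutive terms of the numeration system is `β` up to a summable error. -/
lemma IsBase101.summable_abs_sub {G : ℕ → ℕ} (hG : IsBase101 G) {β : ℝ} (hβ : 1 < β)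
    (hroot : β ^ 3 = β ^ 2 + 1) : Summable (fun k => |(G (k + 1) : ℝ) - β * G k|) := by
  have hβ1 : β < 3 / 2 := by nlinarith [sq_nonneg β, sq_nonneg (β - 3 / 2)]
  have hβ0 : 0 < β := by linarith
  set c := β⁻¹ with hc
  have hcβ : c * β = 1 := inv_mul_cancel₀ hβ0.ne'
  have hc0 : 0 < c := inv_pos.2 hβ0
  have hc1 : c < 1 := inv_lt_one_of_one_lt₀ hβ
  have hc2 : 2 / 3 < c := by nlinarith
  have hcq : c = β ^ 2 - β := by
    have : β * (c - (β ^ 2 - β)) = 0 := by linear_combination hcβ - hroot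
    rcases mul_eq_zero.1 this with h | h <;> linarith
  let u : ℕ → ℝ := fun k => (G (k + 1) : ℝ) - β * G k
  have hu : ∀ k, u (k + 2) = -(β - 1) * u (k + 1) - c * u k := by
    intro k
    have h : (G (k + 3) : ℝ) = G (k + 2) + G k := by exact_mod_cast hG.2.2.2 k
    simp only [u, add_assoc, Nat.reduceAdd, h]
    linear_combination (G k : ℝ) * (-hcβ) + (G (k + 1) : ℝ) * hcq
  let Q : ℕ → ℝ := fun k => u (k + 1) ^ 2 + (β - 1) * u (k + 1) * u k + c * u k ^ 2
  have hQ : ∀ k, Q k = Q 0 * c ^ k := by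
    intro k
    induction k with
    | zero => simp
    | succ k ih =>
      have : Q (k + 1) = c * Q k := by
        simp only [Q, add_assoc, Nat.reduceAdd, hu]
        ring
      rw [this, ih]; ring
  have huQ : ∀ k, u k ^ 2 ≤ 2 * Q k := by
    intro k
    have h1 : (β - 1) ^ 2 ≤ 1 / 4 := by nlinarith
    have h2 := mul_nonneg (sub_nonneg.2 h1) (sq_nonneg (u k))
    have h3 := mul_nonneg (sub_nonneg.2 hc2.le) (sq_nonneg (u k))
    simp only [Q]
    nlinarith [sq_nonneg (u (k + 1) + (β - 1) / 2 * u k), sq_nonneg (u k)]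
  have hsqrt : √c < 1 := by rw [Real.sqrt_lt' one_pos]; simpa using hc1
  refine Summable.of_nonneg_of_le (fun k => abs_nonneg _) (fun k => ?_)
    ((summable_geometric_of_lt_one (Real.sqrt_nonneg c) hsqrt).mul_left √(2 * Q 0))
  have h0 : 0 ≤ 2 * Q 0 := (sq_nonneg _).trans (huQ 0)
  apply abs_le_of_sq_le_sq _ (by positivity)
  have := huQ k
  rw [hQ k] at this
  rw [mul_pow, Real.sq_sqrt h0, ← pow_mul, mul_comm k 2, pow_mul, Real.sq_sqrt hc0.le]
  simp only [u] at this
  linarith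

lemma SparseExpansion.abs_sum_shift_sub_le {G : ℕ → ℕ} {β : ℝ}
    (hsum : Summable (fun k => |(G (k + 1) : ℝ) - β * G k|)) {n : ℕ} {e : ℕ → ℕ}
    (he : SparseExpansion G n e) :
    |((∑ k ∈ Finset.range n, e k * G (k + 1) : ℕ) : ℝ) - β * n| ≤
      ∑' k, |(G (k + 1) : ℝ) - β * G k| := by
  have h1 : ((∑ k ∈ Finset.range n, e k * G (k + 1) : ℕ) : ℝ) - β * n =
      ∑ k ∈ Finset.range n, (e k : ℝ) * ((G (k + 1) : ℝ) - β * G k) := by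
    have h2 : (n : ℝ) = ∑ k ∈ Finset.range n, (e k : ℝ) * G k := by exact_mod_cast he.sum_eq.symm
    rw [h2]
    push_cast
    rw [Finset.mul_sum, ← Finset.sum_sub_distrib]
    exact Finset.sum_congr rfl fun k _ => by ring
  rw [h1]
  refine (Finset.abs_sum_le_sum_abs _ _).trans (le_trans (Finset.sum_le_sum fun k _ => ?_)
    (hsum.sum_le_tsum (Finset.range n) fun k _ => abs_nonneg _))
  rw [abs_mul, Nat.abs_cast]
  have : (e k : ℝ) ≤ 1 := by exact_mod_cast (he.sparse k).1
  exact mul_le_of_le_one_left (abs_nonneg _) this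

section SelfSimilar

open Classical in
/-- The number of `n < N` with `f n < x`. -/
noncomputable def countBelow (f : ℕ → ℝ) (N : ℕ) (x : ℝ) : ℕ :=
  ((Finset.range N).filter (fun n => f n < x)).card

lemma countBelow_le (f : ℕ → ℝ) (N : ℕ) (x : ℝ) : countBelow f N x ≤ N := by
  classical
  simpa [countBelow] using Finset.card_filter_le (Finset.range N) (fun n => f n < x)

lemma countBelow_of_forall_lt {f : ℕ → ℝ} {x : ℝ} (h : ∀ n, f n < x) (N : ℕ) :
    countBelow f N x = N := by
  simp [countBelow, h]

lemma countBelow_of_forall_le {f : ℕ → ℝ} {x : ℝ} (h : ∀ n, x ≤ f n) (N : ℕ) :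
    countBelow f N x = 0 := by
  simp [countBelow, h]

lemma exists_lt_iff_apply_lt {S : ℕ → ℕ} (hS : StrictMono S) (N : ℕ) :
    ∃ P, ∀ m, S m < N ↔ m < P := by
  have h : ∃ m, N ≤ S m := ⟨N, hS.le_apply⟩
  refine ⟨Nat.find h, fun m => ?_⟩
  rw [Nat.lt_find_iff]
  exact ⟨fun hm k hk => not_le.2 ((hS.monotone hk).trans_lt hm), fun hm => not_le.1 (hm m le_rfl)⟩

lemma countBelow_split {S T : ℕ → ℕ} (hS : StrictMono S) (hT : StrictMono T)
    (hcover : ∀ n, (∃ m, S m = n) ∨ ∃ m, T m = n) (hdisj : ∀ m l, S m ≠ T l)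
    {N P Q : ℕ} (hP : ∀ m, S m < N ↔ m < P) (hQ : ∀ m, T m < N ↔ m < Q) (f : ℕ → ℝ) (x : ℝ) :
    countBelow f N x = countBelow (f ∘ S) P x + countBelow (f ∘ T) Q x := by
  classical
  have hset : (Finset.range N).filter (fun n => f n < x) =
      ((Finset.range P).filter (fun n => (f ∘ S) n < x)).image S ∪
      ((Finset.range Q).filter (fun n => (f ∘ T) n < x)).image T := by
    ext n
    simp only [Finset.mem_filter, Finset.mem_range, Finset.mem_union, Finset.mem_image,
      Function.comp_apply]
    constructor
    · rintro ⟨hn, hx⟩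
      rcases hcover n with ⟨m, rfl⟩ | ⟨m, rfl⟩
      · exact Or.inl ⟨m, ⟨(hP m).1 hn, hx⟩, rfl⟩
      · exact Or.inr ⟨m, ⟨(hQ m).1 hn, hx⟩, rfl⟩
    · rintro (⟨m, ⟨hm, hx⟩, rfl⟩ | ⟨m, ⟨hm, hx⟩, rfl⟩)
      · exact ⟨(hP m).2 hm, hx⟩
      · exact ⟨(hQ m).2 hm, hx⟩
  unfold countBelow
  rw [hset, Finset.card_union_of_disjoint, Finset.card_image_of_injective _ hS.injective,
    Finset.card_image_of_injective _ hT.injective]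
  rw [Finset.disjoint_left]
  intro n h1 h2
  obtain ⟨m, _, rfl⟩ := Finset.mem_image.1 h1
  obtain ⟨l, _, h⟩ := Finset.mem_image.1 h2
  exact hdisj m l h.symm

lemma abs_mul_sub_le_of_lt_iff {S : ℕ → ℕ} {β C : ℝ} (hβ : 0 < β)
    (hC : ∀ m, |(S m : ℝ) - β * m| ≤ C) {N P : ℕ} (hP : ∀ m, S m < N ↔ m < P) :
    |β * P - N| ≤ C + β := by
  have h1 : N ≤ S P := not_lt.1 fun h => lt_irrefl P ((hP P).1 h)
  have h1' : (N : ℝ) ≤ S P := by exact_mod_cast h1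
  have h2 := abs_le.1 (hC P)
  rw [abs_le]
  refine ⟨by linarith, ?_⟩
  rcases Nat.eq_zero_or_pos P with rfl | hpos
  · have h3 := (abs_nonneg _).trans (hC 0)
    have : (0 : ℝ) ≤ N := N.cast_nonneg
    push_cast
    linarith
  · obtain ⟨p, rfl⟩ := Nat.exists_eq_succ_of_ne_zero hpos.ne'
    have h3 : (S p : ℝ) ≤ N := by exact_mod_cast ((hP p).2 (Nat.lt_succ_self p)).le
    have h4 := abs_le.1 (hC p)
    push_cast
    linarith

variable {f : ℕ → ℝ} {S T : ℕ → ℕ} {β C : ℝ}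

lemma selfSimilar_lt_one (hβ : 1 < β) (hroot : β ^ 3 = β ^ 2 + 1) (hS : StrictMono S)
    (hTlt : ∀ m, m < T m) (hcover : ∀ n, (∃ m, S m = n) ∨ ∃ m, T m = n)
    (hfS : ∀ m, f (S m) = f m / β) (hfT : ∀ m, f (T m) = 1 / β + f m / β ^ 3) (n : ℕ) :
    f n < 1 := by
  have hβ0 : 0 < β := by linarith
  induction n using Nat.strong_induction_on with
  | _ n ih =>
    rcases hcover n with ⟨m, rfl⟩ | ⟨m, rfl⟩
    · rcases (hS.le_apply : m ≤ S m).lt_or_eq with h | h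
      · rw [hfS, div_lt_one hβ0]
        linarith [ih m h]
      · have h1 := hfS m
        rw [← h, eq_div_iff hβ0.ne'] at h1
        rw [← h]
        have : f m * (β - 1) = 0 := by linear_combination h1
        rcases mul_eq_zero.1 this with h | h <;> linarith
    · have h1 := ih m (hTlt m)
      have h2 : f m / β ^ 3 < 1 / β ^ 3 := by gcongr
      have h3 : 1 / β + 1 / β ^ 3 = 1 := by field_simp; linarith
      rw [hfT]
      linarith

/-- The discrepancy of a self-similar sequence grows slower than linearly. -/
lemma selfSimilar_discrepancy (hβ : 1 < β) (hroot : β ^ 3 = β ^ 2 + 1) (hS : StrictMono S)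
    (hT : StrictMono T) (hcover : ∀ n, (∃ m, S m = n) ∨ ∃ m, T m = n)
    (hdisj : ∀ m l, S m ≠ T l) (hf0 : ∀ n, 0 ≤ f n) (hf1 : ∀ n, f n < 1)
    (hfS : ∀ m, f (S m) = f m / β) (hfT : ∀ m, f (T m) = 1 / β + f m / β ^ 3)
    (hC : ∀ m, |(S m : ℝ) - β * m| ≤ C) {δ : ℝ} (hδ : 0 < δ) :
    ∃ B, ∀ N : ℕ, ∀ x, 0 ≤ x → x ≤ 1 → |(countBelow f N x : ℝ) - x * N| ≤ δ * N + B := by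
  have hβ0 : 0 < β := by linarith
  have hβ2 : β < 2 := by nlinarith [sq_nonneg β]
  have hC0 : 0 ≤ C := (abs_nonneg _).trans (hC 0)
  set D := C + β with hD
  have hD0 : 0 < D := by linarith
  have hcβ : 1 / β + 1 / β ^ 3 = 1 := by field_simp; linarith
  obtain ⟨N₀, hN₀⟩ := exists_nat_ge ((D / δ * β + D) / (β - 1))
  rw [div_le_iff₀ (by linarith)] at hN₀
  refine ⟨N₀, fun N => ?_⟩
  induction N using Nat.strong_induction_on with
  | _ N ih =>
  intro x hx0 hx1
  rcases le_total N N₀ with hN | hN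
  · have h1 : (countBelow f N x : ℝ) ≤ N := by exact_mod_cast countBelow_le f N x
    have h2 : (0 : ℝ) ≤ countBelow f N x := Nat.cast_nonneg _
    have h3 : (N : ℝ) ≤ N₀ := by exact_mod_cast hN
    have h4 : (0 : ℝ) ≤ N := Nat.cast_nonneg _
    have h5 : x * N ≤ N := mul_le_of_le_one_left h4 hx1
    have h6 : 0 ≤ x * N := by positivity
    have h7 : 0 ≤ δ * N := by positivity
    rw [abs_le]
    constructor <;> linarith
  obtain ⟨P, hP⟩ := exists_lt_iff_apply_lt hS N
  obtain ⟨Q, hQ⟩ := exists_lt_iff_apply_lt hT N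
  have hsplit := countBelow_split hS hT hcover hdisj hP hQ f
  have hPQ : N = P + Q := by
    have := hsplit 1
    rwa [countBelow_of_forall_lt hf1, countBelow_of_forall_lt (f := f ∘ S) fun n => hf1 (S n),
      countBelow_of_forall_lt (f := f ∘ T) fun n => hf1 (T n)] at this
  have hPQ' : (N : ℝ) = P + Q := by exact_mod_cast hPQ
  have hPN : |β * P - N| ≤ D := abs_mul_sub_le_of_lt_iff hβ0 hC hP
  have hPN' := abs_le.1 hPN
  have hNN₀ : (N₀ : ℝ) ≤ N := by exact_mod_cast hN
  have hlarge : D / δ * β + D ≤ (β - 1) * N := by nlinarith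
  have hDδ : 0 < D / δ := by positivity
  have hQlarge : D / δ ≤ Q := by
    refine le_of_mul_le_mul_right ?_ hβ0
    nlinarith
  have hPlarge : D / δ ≤ P := by
    refine le_of_mul_le_mul_right ?_ hβ0
    nlinarith [(Nat.cast_nonneg N : (0 : ℝ) ≤ N)]
  rw [div_le_iff₀ hδ] at hQlarge hPlarge
  have hQpos : 0 < Q := by
    rcases Nat.eq_zero_or_pos Q with rfl | h
    · simp at hQlarge; linarith
    · exact h
  have hPpos : 0 < P := by
    rcases Nat.eq_zero_or_pos P with rfl | h
    · simp at hPlarge; linarith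
    · exact h
  have hcS : ∀ x, countBelow (f ∘ S) P x = countBelow f P (β * x) := by
    intro x
    simp only [countBelow, Function.comp_apply, hfS, div_lt_iff₀ hβ0, mul_comm β x]
  have hcT : ∀ x, countBelow (f ∘ T) Q x = countBelow f Q (β ^ 3 * (x - 1 / β)) := by
    intro x
    have h : ∀ y, 1 / β + y / β ^ 3 < x ↔ y < β ^ 3 * (x - 1 / β) := by
      intro y
      rw [← lt_sub_iff_add_lt', div_lt_iff₀ (by positivity), mul_comm]
    simp only [countBelow, Function.comp_apply, hfT, h]
  have hδN : δ * N = P * δ + Q * δ := by rw [hPQ']; ring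
  rw [hsplit x]
  rcases le_total x (1 / β) with hx | hx
  · have hT0 : countBelow (f ∘ T) Q x = 0 := by
      refine countBelow_of_forall_le (fun n => ?_) Q
      have : 0 ≤ f n / β ^ 3 := div_nonneg (hf0 n) (by positivity)
      simp only [Function.comp_apply, hfT]
      linarith
    have hβx : β * x ≤ 1 := by rwa [le_div_iff₀ hβ0, mul_comm] at hx
    have h1 := ih P (by omega) (β * x) (by positivity) hβx
    have h2 : |x * (β * P - N)| ≤ D := by
      rw [abs_mul, abs_of_nonneg hx0]
      exact (mul_le_of_le_one_left (abs_nonneg _) hx1).trans hPN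
    have h3 : x * N = β * x * P - x * (β * P - N) := by ring
    rw [hT0, hcS, Nat.add_zero, h3, hδN]
    rw [abs_le] at h1 h2 ⊢
    constructor <;> linarith
  · have hS1 : countBelow (f ∘ S) P x = P := by
      refine countBelow_of_forall_lt (fun n => ?_) P
      simp only [Function.comp_apply, hfS]
      exact lt_of_lt_of_le (by gcongr; exact hf1 n) hx
    set y := β ^ 3 * (x - 1 / β) with hy
    have hy0 : 0 ≤ y := mul_nonneg (by positivity) (by linarith)
    have hxy : x = 1 / β + y * (1 / β ^ 3) := by rw [hy]; field_simp; ring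
    have hy1 : y ≤ 1 := by
      have h3 : β ^ 3 * (x - 1 / β) ≤ β ^ 3 * (1 / β ^ 3) := by
        gcongr; linarith
      rwa [mul_one_div_cancel (by positivity)] at h3
    have h1 := ih Q (by omega) y hy0 hy1
    have hPN1 : |(P : ℝ) - N * (1 / β)| ≤ D := by
      have : (P : ℝ) - N * (1 / β) = (β * P - N) * (1 / β) := by field_simp
      rw [this, abs_mul, abs_of_nonneg (by positivity : 0 ≤ 1 / β)]
      exact (mul_le_of_le_one_right (abs_nonneg _)
        (by rw [div_le_one hβ0]; exact hβ.le)).trans hPN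
    have h2 : |(1 - y) * ((P : ℝ) - N * (1 / β))| ≤ D := by
      rw [abs_mul, abs_of_nonneg (by linarith : 0 ≤ 1 - y)]
      exact (mul_le_of_le_one_left (abs_nonneg _) (by linarith)).trans hPN1
    have h3 : x * N = P + y * Q - (1 - y) * ((P : ℝ) - N * (1 / β)) := by
      rw [hxy]
      have : (Q : ℝ) = N - P := by linarith
      rw [this]
      linear_combination (y * N) * hcβ
    rw [hS1, hcT, ← hy, h3, hδN]
    push_cast
    rw [abs_le] at h1 h2 ⊢
    constructor <;> linarith

end SelfSimilar

open Classical in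
lemma sum_indicator_Ico_eq (f : ℕ → ℝ) {a b : ℝ} (hab : a ≤ b) (N : ℕ) :
    ∑ n ∈ Finset.range N, Set.indicator (Set.Ico a b) (fun _ => (1 : ℝ)) (f n) =
      countBelow f N b - countBelow f N a := by
  simp only [countBelow, Finset.card_filter, Nat.cast_sum, ← Finset.sum_sub_distrib]
  refine Finset.sum_congr rfl fun n _ => ?_
  by_cases h1 : f n < a
  · simp [h1, h1.trans_le hab]
  · by_cases h2 : f n < b <;> simp [Set.indicator, h1, h2]

lemma isUDOne_of_discrepancy {f : ℕ → ℝ}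
    (h : ∀ δ : ℝ, 0 < δ → ∃ B, ∀ N : ℕ, ∀ x, 0 ≤ x → x ≤ 1 →
      |(countBelow f N x : ℝ) - x * N| ≤ δ * N + B) : IsUDOne f := by
  intro a b ha hab hb
  rw [Metric.tendsto_atTop]
  intro η hη
  obtain ⟨B, hB⟩ := h (η / 4) (by positivity)
  obtain ⟨N₀, hN₀⟩ := exists_nat_gt ((2 * B + η + 2) / (η / 2))
  rw [div_lt_iff₀ (by positivity)] at hN₀
  refine ⟨N₀ + 1, fun N hN => ?_⟩
  have hN0 : (N₀ : ℝ) + 1 ≤ N := by exact_mod_cast hN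
  have hNpos : (0 : ℝ) < N := lt_of_lt_of_le (by positivity) hN0
  have hsum : ∑ n ∈ Finset.Icc 1 N, Set.indicator (Set.Ico a b) (fun _ => (1 : ℝ)) (f n) =
      countBelow f (N + 1) b - countBelow f (N + 1) a -
        Set.indicator (Set.Ico a b) (fun _ => (1 : ℝ)) (f 0) := by
    rw [← sum_indicator_Ico_eq f hab, Finset.sum_range_succ', Finset.range_eq_Ico,
      Finset.sum_Ico_add' (fun n => Set.indicator (Set.Ico a b) (fun _ => (1 : ℝ)) (f n)) 0 N 1,
      add_sub_cancel_right]
    rfl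
  have hi : Set.indicator (Set.Ico a b) (fun _ => (1 : ℝ)) (f 0) ∈ Set.Icc (0 : ℝ) 1 := by
    by_cases h0 : f 0 ∈ Set.Ico a b <;> simp [h0]
  have h1 := abs_le.1 (hB (N + 1) a ha (hab.trans hb))
  have h2 := abs_le.1 (hB (N + 1) b (ha.trans hab) hb)
  push_cast at h1 h2
  rw [Real.dist_eq, hsum, div_sub' hNpos.ne', abs_div, abs_of_pos hNpos, div_lt_iff₀ hNpos, abs_lt]
  have h3 : (N₀ : ℝ) * (η / 2) ≤ N * (η / 2) := by gcongr; linarith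
  constructor <;> nlinarith [hi.1, hi.2]

lemma isUDOne_congr {x y : ℕ → ℝ} (h : ∀ n, 1 ≤ n → x n = y n) (hx : IsUDOne x) : IsUDOne y := by
  intro a b ha hab hb
  refine (hx a b ha hab hb).congr fun N => ?_
  congr 1
  exact Finset.sum_congr rfl fun n hn => by rw [h n (Finset.mem_Icc.1 hn).1]

theorem isUDOne_monna_sparseExpansion {G : ℕ → ℕ} (hG : IsBase101 G) {β : ℝ} (hβ : 1 < β)
    (hroot : β ^ 3 = β ^ 2 + 1) {d : ℕ → ℕ → ℕ} (hd : ∀ n, SparseExpansion G n (d n)) :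
    IsUDOne (fun n => monna β (d n)) := by
  have hβ0 : 0 < β := by linarith
  let S : ℕ → ℕ := fun m => ∑ k ∈ Finset.range m, d m k * G (k + 1)
  let T : ℕ → ℕ := fun m => 1 + ∑ k ∈ Finset.range m, d m k * G (k + 3)
  have hS : StrictMono S := fun m n h => (hd m).sum_shift_lt hG (hd n) h 1
  have hT : StrictMono T := fun m n h => by
    simpa [T] using (hd m).sum_shift_lt hG (hd n) h 3
  have hdS : ∀ m, d (S m) = consDigit 0 (d m) := fun m =>
    SparseExpansion.unique hG (hd _) ((hd m).cons_zero hG)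
  have hdT : ∀ m, d (T m) = consDigit 1 (consDigit 0 (consDigit 0 (d m))) := fun m =>
    SparseExpansion.unique hG (hd _) ((hd m).cons_one hG)
  have hinj : ∀ {m n}, d m = d n → m = n := by
    intro m n h
    have hm := (hd m).sum_range (le_max_left m n)
    rwa [h, (hd n).sum_range (le_max_right m n), eq_comm] at hm
  have hcover : ∀ n, (∃ m, S m = n) ∨ ∃ m, T m = n := by
    intro n
    have htail : ∀ n, ∃ m, d m = fun k => d n (k + 1) := fun n =>
      ⟨_, SparseExpansion.unique hG (hd _) ((hd n).tail hG)⟩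
    obtain ⟨m, hm⟩ := htail n
    obtain ⟨m', hm'⟩ := htail m
    obtain ⟨m'', hm''⟩ := htail m'
    have h1 := (hd n).sparse 0
    obtain h0 | h0 : d n 0 = 0 ∨ d n 0 = 1 := by omega
    · refine Or.inl ⟨m, hinj ?_⟩
      rw [hdS, hm]
      funext k
      cases k <;> simp [consDigit, h0]
    · refine Or.inr ⟨m'', hinj ?_⟩
      have h2 := h1.2 h0
      rw [hdT, hm'', hm', hm]
      funext k
      match k with
      | 0 => simp [consDigit, h0]
      | 1 => simpa [consDigit] using h2.1.symm
      | 2 => simpa [consDigit] using h2.2.symm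
      | k + 3 => simp [consDigit]
  have hdisj : ∀ m l, S m ≠ T l := by
    intro m l h
    have := congrFun (congrArg d h) 0
    rw [hdS, hdT] at this
    simp [consDigit] at this
  have hf0 : ∀ n, 0 ≤ monna β (d n) := fun n => tsum_nonneg fun k => by positivity
  have hfS : ∀ m, monna β (d (S m)) = monna β (d m) / β := by
    intro m
    rw [hdS, monna_consDigit _ ((hd m).summable β)]
    simp
  have hfT : ∀ m, monna β (d (T m)) = 1 / β + monna β (d m) / β ^ 3 := by
    intro m
    have h0 := (hd m).summable β
    rw [hdT, monna_consDigit _ (summable_consDigit _ (summable_consDigit _ h0)),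
      monna_consDigit _ (summable_consDigit _ h0), monna_consDigit _ h0]
    field_simp
    simp
  have hTlt : ∀ m, m < T m := by
    intro m
    have h1 : m ≤ ∑ k ∈ Finset.range m, d m k * G (k + 3) := by
      conv_lhs => rw [← (hd m).sum_eq]
      exact Finset.sum_le_sum fun k _ => Nat.mul_le_mul_left _ (hG.strictMono.monotone (by omega))
    simp only [T]
    omega
  have hsum := hG.summable_abs_sub hβ hroot
  exact isUDOne_of_discrepancy fun δ hδ => selfSimilar_discrepancy hβ hroot hS hT hcover hdisj hf0
    (selfSimilar_lt_one hβ hroot hS hTlt hcover hfS hfT) hfS hfT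
    (fun m => (hd m).abs_sum_shift_sub_le hsum) hδ

/-- The β-adic van der Corput sequence for the numeration system with
coefficients (1,0,1), i.e. G₀ = 1, G₁ = 2, G₂ = 3, G_{n+3} = G_{n+2} + G_n,
where β > 1 satisfies β³ = β² + 1, is uniformly distributed in [0,1). -/
theorem vdc_101_ud (G : ℕ → ℕ)
    (hG : G 0 = 1 ∧ G 1 = 2 ∧ G 2 = 3 ∧ ∀ n, G (n + 3) = G (n + 2) + G n)
    (β : ℝ) (hβ : 1 < β) (hroot : β ^ 3 = β ^ 2 + 1)
    (ε : ℕ → ℕ → ℕ) (hε : ∀ n, 1 ≤ n → IsGExpansion G n (ε n)) :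
    IsUDOne (fun n => monna β (ε n)) := by
  have hG' : IsBase101 G := hG
  let d : ℕ → ℕ → ℕ := fun n => if n = 0 then fun _ => 0 else ε n
  have hd : ∀ n, SparseExpansion G n (d n) := by
    intro n
    rcases Nat.eq_zero_or_pos n with rfl | h
    · simpa [d] using SparseExpansion.zero
    · simpa [d, h.ne'] using hG'.sparseExpansion_of_isGExpansion (hε n h)
  refine isUDOne_congr (fun n hn => ?_) (isUDOne_monna_sparseExpansion hG' hβ hroot hd)
  simp [d, Nat.one_le_iff_ne_zero.1 hn]
end

section
/- Let G be the numeration system with coefficients (a_0, a_1, a_2) = (1, 0, 1), i.e., G_0 = 1, G_1 = 2, G_2 = 3 and G_{n+3} = G_{n+2} + G_n for n ≥ 0, let β be the unique real root greater than 1 of x³ = x² + 1, and let τ be the odometer on the space K_G of G-admissible digit sequences. Then for every ε ∈ K_G the sequence (φ_β(τ^n ε))_{n≥0} is uniformly distributed in [0,1); that is, the transformation T = φ_β ∘ τ ∘ φ_β^+ has uniformly distributed orbits starting from every point. -/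
open MeasureTheory Filter

/-- The compact space `K_G` of `G`-admissible digit sequences, i.e. sequences
`e` of nonnegative integers with `∑_{k<K} e k * G k < G K` for every `K ≥ 1`,
with the topology induced by the product topology. -/
abbrev KG (G : ℕ → ℕ) : Type :=
  {e : ℕ → ℕ // ∀ K, 1 ≤ K → ∑ k ∈ Finset.range K, e k * G k < G K}

/-- Membership in `K_G^0`: there is `M` such that
`∑_{k ≤ j} e k * G k < G (j+1) - 1` for all `j ≥ M`. -/
def MemKG0 (G : ℕ → ℕ) (e : ℕ → ℕ) : Prop :=
  ∃ M : ℕ, ∀ j, M ≤ j → ∑ k ∈ Finset.range (j + 1), e k * G k < G (j + 1) - 1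

/-- `τ` is the `G`-odometer on `K_G`: on `K_G^0` it replaces, for any suitable
index `j`, the digits up to `j` by the greedy expansion digits of
`(∑_{k ≤ j} e k * G k) + 1` and leaves the digits above `j` unchanged; outside
`K_G^0` it is the zero sequence. -/
def IsOdometer (G : ℕ → ℕ) (τ : KG G → KG G) : Prop :=
  ∀ e : KG G,
    (MemKG0 G e.val →
      ∀ j, (∀ i, j ≤ i → ∑ k ∈ Finset.range (i + 1), e.val k * G k < G (i + 1) - 1) →
        ((∃ e' : ℕ → ℕ,
            IsGExpansion G (∑ k ∈ Finset.range (j + 1), e.val k * G k + 1) e' ∧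
            ∀ i, i ≤ j → (τ e).val i = e' i) ∧
          ∀ i, j < i → (τ e).val i = e.val i)) ∧
    (¬ MemKG0 G e.val → ∀ i, (τ e).val i = 0)

/-- A sequence `(x n)_{n ≥ 0}` is uniformly distributed in `[0,1)`. -/
def IsUDZero (x : ℕ → ℝ) : Prop :=
  ∀ a b : ℝ, 0 ≤ a → a ≤ b → b ≤ 1 →
    Tendsto (fun N : ℕ =>
        (∑ n ∈ Finset.range N, Set.indicator (Set.Ico a b) (fun _ => (1 : ℝ)) (x n)) / (N : ℝ))
      atTop (nhds (b - a))

/-- The Monna map of the greedy `G`-expansion of `n`, read off its digits below `j`. -/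
noncomputable def radicalInverse (G : ℕ → ℕ) (β : ℝ) : ℕ → ℕ → ℝ
  | 0, _ => 0
  | j + 1, n =>
    if G j ≤ n then radicalInverse G β j (n - G j) + 1 / β ^ (j + 1)
    else radicalInverse G β j n

/-- The value `∑_{k < j} e k * G k` of the first `j` digits. -/
def prefixValue (G : ℕ → ℕ) (e : ℕ → ℕ) (j : ℕ) : ℕ := ∑ k ∈ Finset.range j, e k * G k

/-- The sum of `f` over the radical inverses of the integers below `G j`. -/
noncomputable def radicalSum (G : ℕ → ℕ) (β : ℝ) (j : ℕ) (f : ℝ → ℝ) : ℝ :=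
  ∑ n ∈ Finset.range (G j), f (radicalInverse G β j n)

/-- The indicator function of the half-line `(-∞, x)`. -/
noncomputable def indicatorLT (x y : ℝ) : ℝ := if y < x then 1 else 0

section Recurrence

variable {G : ℕ → ℕ} (h0 : G 0 = 1) (hs : ∀ n, G (n + 1) = G n + G (n - 2))

include hs in
lemma mono_of_recurrence : Monotone G :=
  monotone_nat_of_le_succ fun n => by rw [hs n]; omega

include h0 hs in
lemma pos_of_recurrence (n : ℕ) : 0 < G n := by
  have := mono_of_recurrence hs (Nat.zero_le n)
  omega

include h0 hs in
lemma succ_le_of_recurrence (n : ℕ) : n + 1 ≤ G n := by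
  induction n with
  | zero => omega
  | succ n ih =>
    have := pos_of_recurrence h0 hs (n - 2)
    rw [hs n]; omega

include h0 hs in
lemma sq_le_of_recurrence (n : ℕ) : (n + 1) ^ 2 ≤ 10 * G n := by
  induction n with
  | zero => omega
  | succ n ih =>
    have := succ_le_of_recurrence h0 hs (n - 2)
    have h2 : n ≤ n - 2 + 2 := by omega
    rw [hs n]; nlinarith

lemma prefixValue_succ (e : ℕ → ℕ) (j : ℕ) :
    prefixValue G e (j + 1) = prefixValue G e j + e j * G j := Finset.sum_range_succ _ _

include h0 in
lemma prefixValue_lt (e : KG G) (j : ℕ) : prefixValue G e.val j < G j := by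
  rcases Nat.eq_zero_or_pos j with rfl | hj
  · simp [prefixValue, h0]
  · exact e.2 j hj

lemma prefixValue_mono (e : ℕ → ℕ) : Monotone (prefixValue G e) :=
  monotone_nat_of_le_succ fun n => by rw [prefixValue_succ]; omega

include h0 hs in
lemma digit_le_one (e : KG G) (j : ℕ) : e.val j ≤ 1 := by
  have h1 := prefixValue_lt h0 e (j + 1)
  rw [prefixValue_succ, hs j] at h1
  have h2 := mono_of_recurrence hs (Nat.sub_le j 2)
  by_contra! h
  nlinarith [Nat.mul_le_mul_right (G j) h]

include h0 hs in
lemma digit_cases (e : KG G) (j : ℕ) :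
    (e.val j = 0 ∧ prefixValue G e.val (j + 1) = prefixValue G e.val j) ∨
    (e.val j = 1 ∧ prefixValue G e.val (j + 1) = prefixValue G e.val j + G j) := by
  have := digit_le_one h0 hs e j
  have h : e.val j = 0 ∨ e.val j = 1 := by omega
  rcases h with h | h <;> simp [prefixValue_succ, h]

lemma radicalInverse_eq_of_le (β : ℝ) (hm : Monotone G) {j i n : ℕ} (hij : j ≤ i) (hn : n < G j) :
    radicalInverse G β i n = radicalInverse G β j n := by
  induction i, hij using Nat.le_induction with
  | base => rfl
  | succ i hi ih =>
    have := hm hi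
    rw [radicalInverse, if_neg (by omega), ih]

include h0 hs in
lemma radicalInverse_prefixValue (β : ℝ) (e : KG G) (m : ℕ) :
    radicalInverse G β m (prefixValue G e.val m) =
      ∑ k ∈ Finset.range m, (e.val k : ℝ) / β ^ (k + 1) := by
  induction m with
  | zero => simp [radicalInverse]
  | succ m ih =>
    rw [Finset.sum_range_succ, ← ih, radicalInverse]
    have h1 := prefixValue_lt h0 e m
    rcases digit_cases h0 hs e m with ⟨h, h'⟩ | ⟨h, h'⟩
    · rw [h', if_neg (by omega), h]; simp
    · rw [h', if_pos (by omega), h]; simp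

include h0 in
lemma radicalSum_zero (β : ℝ) (f : ℝ → ℝ) : radicalSum G β 0 f = f 0 := by
  simp [radicalSum, h0, radicalInverse]

include hs in
lemma radicalSum_succ (β : ℝ) (j : ℕ) (f : ℝ → ℝ) :
    radicalSum G β (j + 1) f =
      radicalSum G β j f + radicalSum G β (j - 2) (fun y => f (y + 1 / β ^ (j + 1))) := by
  have hm := mono_of_recurrence hs
  unfold radicalSum
  rw [hs j, Finset.sum_range_add]
  congr 1
  · refine Finset.sum_congr rfl fun n hn => ?_
    rw [Finset.mem_range] at hn
    rw [radicalInverse, if_neg (by omega)]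
  · refine Finset.sum_congr rfl fun n hn => ?_
    rw [Finset.mem_range] at hn
    rw [radicalInverse, if_pos (by omega), Nat.add_sub_cancel_left,
      radicalInverse_eq_of_le β hm (Nat.sub_le j 2) hn]

include h0 hs in
/-- Splitting according to the lowest digit rather than the highest one. -/
lemma radicalSum_succ' {β : ℝ} (hβ : 1 < β) (j : ℕ) (f : ℝ → ℝ) :
    radicalSum G β (j + 1) f =
      radicalSum G β j (fun y => f (y / β)) +
        radicalSum G β (j - 2) (fun y => f (1 / β + y / β ^ 3)) := by
  have hb : β ≠ 0 := by positivity
  induction j using Nat.strong_induction_on generalizing f with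
  | _ j ih =>
    match j with
    | 0 => simp [radicalSum_succ hs, radicalSum_zero h0]
    | 1 =>
      simp only [radicalSum_succ hs, radicalSum_zero h0]
      have : (0 + 1 / β ^ (0 + 1)) / β = 0 + 1 / β ^ (1 + 1) := by field_simp; ring
      rw [this]; simp; ring
    | 2 =>
      rw [radicalSum_succ hs, ih 1 (by norm_num)]
      rw [radicalSum_succ hs β 1 fun y => f (y / β)]
      simp only [Nat.reduceSub, radicalSum_zero h0]
      have : (0 + 1 / β ^ (1 + 1)) / β = 0 + 1 / β ^ (2 + 1) := by field_simp; ring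
      rw [this]; ring
    | k + 3 =>
      rw [radicalSum_succ hs, ih (k + 2) (by omega)]
      simp only [show k + 3 - 2 = k + 1 by omega, show k + 2 - 2 = k by omega]
      rw [ih k (by omega), radicalSum_succ hs β (k + 2),
        radicalSum_succ hs β k fun y => f (1 / β + y / β ^ 3)]
      simp only [show k + 2 - 2 = k by omega]
      have e1 : ∀ y : ℝ, (y + 1 / β ^ (k + 2 + 1)) / β = y / β + 1 / β ^ (k + 3 + 1) := by
        intro y; field_simp; ring
      have e2 : ∀ y : ℝ, 1 / β + (y + 1 / β ^ (k + 1)) / β ^ 3 =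
          1 / β + y / β ^ 3 + 1 / β ^ (k + 3 + 1) := by
        intro y; field_simp; ring
      simp only [e1, e2]
      ring

include h0 hs in
lemma radicalSum_indicatorLT_succ {β : ℝ} (hβ : 1 < β) (j : ℕ) (x : ℝ) :
    radicalSum G β (j + 1) (indicatorLT x) =
      radicalSum G β j (indicatorLT (β * x)) +
        radicalSum G β (j - 2) (indicatorLT (β ^ 3 * x - β ^ 2)) := by
  rw [radicalSum_succ' h0 hs hβ]
  have hb : 0 < β := by positivity
  congr 2 <;> funext y <;> unfold indicatorLT <;> congr 1 <;> apply propext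
  · rw [div_lt_iff₀ hb, mul_comm]
  · have : 1 / β + y / β ^ 3 < x ↔ y / β ^ 3 < x - 1 / β := by
      constructor <;> intro h <;> linarith
    rw [this, div_lt_iff₀ (by positivity)]
    have : (x - 1 / β) * β ^ 3 = β ^ 3 * x - β ^ 2 := by field_simp
    rw [this]

include h0 hs in
lemma radicalSum_indicatorLT_of_nonpos {β : ℝ} (hβ : 1 < β) (j : ℕ) {x : ℝ} (hx : x ≤ 0) :
    radicalSum G β j (indicatorLT x) = 0 := by
  induction j using Nat.strong_induction_on generalizing x with
  | _ j ih =>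
    match j with
    | 0 => rw [radicalSum_zero h0, indicatorLT, if_neg (by linarith)]
    | j + 1 =>
      rw [radicalSum_indicatorLT_succ h0 hs hβ, ih j (by omega), ih (j - 2) (by omega), add_zero]
      · have : β ^ 3 * x ≤ 0 := mul_nonpos_of_nonneg_of_nonpos (by positivity) hx
        nlinarith [sq_nonneg β]
      · exact mul_nonpos_of_nonneg_of_nonpos (by positivity) hx

include h0 hs in
lemma radicalSum_indicatorLT_of_one_lt {β : ℝ} (hβ : 1 < β) (hroot : β ^ 3 = β ^ 2 + 1) (j : ℕ)
    {x : ℝ} (hx : 1 < x) : radicalSum G β j (indicatorLT x) = G j := by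
  induction j using Nat.strong_induction_on generalizing x with
  | _ j ih =>
    match j with
    | 0 => rw [radicalSum_zero h0, indicatorLT, if_pos (by linarith), h0, Nat.cast_one]
    | j + 1 =>
      rw [radicalSum_indicatorLT_succ h0 hs hβ, ih j (by omega), ih (j - 2) (by omega), hs j,
        Nat.cast_add]
      · have : 0 < β ^ 3 := by positivity
        nlinarith
      · nlinarith

include hs in
/-- The conjugates of `β` have modulus less than one, so `G` is nearly geometric. -/
lemma exists_abs_sub_mul_le {β : ℝ} (hβ : 1 < β) (hroot : β ^ 3 = β ^ 2 + 1) :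
    ∃ U : ℝ, ∀ n, |(G (n + 1) : ℝ) - β * G n| ≤ U := by
  set u : ℕ → ℝ := fun n => (G (n + 1) : ℝ) - β * G n with hu
  have hb : 0 < β := by positivity
  have hrec : ∀ n, u (n + 2) = -(β - 1) * u (n + 1) - u n / β := by
    intro n
    have hg : (G (n + 3) : ℝ) = G (n + 2) + G n := by
      have := hs (n + 2)
      simp only [show n + 2 - 2 = n by omega] at this
      exact_mod_cast this
    simp only [hu]
    rw [show n + 2 + 1 = n + 3 by ring, show n + 1 + 1 = n + 2 by ring, hg]
    field_simp
    linear_combination (-(G (n + 1) : ℝ)) * hroot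
  set Q : ℕ → ℝ := fun n => u (n + 1) ^ 2 + (β - 1) * u (n + 1) * u n + u n ^ 2 / β with hQ
  have hlow : ∀ n, u n ^ 2 ≤ 2 * β * Q n := by
    intro n
    have h1 : 2 * β * Q n =
        2 * β * (u (n + 1) + (β - 1) / 2 * u n) ^ 2 +
          (2 - β * (β - 1) ^ 2 / 2) * u n ^ 2 := by
      simp only [hQ]; field_simp; ring
    have h2 : β * (β - 1) ^ 2 ≤ 2 := by
      have : β * (β - 1) ^ 2 ≤ β ^ 2 * (β - 1) := by nlinarith [mul_pos hb (sub_pos.2 hβ)]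
      nlinarith
    rw [h1]
    nlinarith [sq_nonneg (u n), mul_nonneg hb.le (sq_nonneg (u (n + 1) + (β - 1) / 2 * u n))]
  have hstep : ∀ n, Q (n + 1) ≤ Q n := by
    intro n
    have h1 : Q (n + 1) = Q n / β := by
      simp only [hQ]
      rw [show n + 1 + 1 = n + 2 by ring, hrec n]
      field_simp
      ring
    rw [h1]
    refine div_le_self ?_ hβ.le
    have := hlow n
    by_contra! h
    nlinarith [sq_nonneg (u n)]
  have hle : ∀ n, Q n ≤ Q 0 := by
    intro n
    induction n with
    | zero => rfl
    | succ n ih => exact (hstep n).trans ih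
  refine ⟨2 * β * Q 0 + 1, fun n => ?_⟩
  have h1 : u n ^ 2 ≤ 2 * β * Q 0 :=
    (hlow n).trans (mul_le_mul_of_nonneg_left (hle n) (by positivity))
  change |u n| ≤ _
  rw [abs_le]
  constructor <;> nlinarith

include h0 hs in
/-- The radical inverses of the integers below `G j` have logarithmic discrepancy. -/
lemma exists_discrepancy_le {β : ℝ} (hβ : 1 < β) (hroot : β ^ 3 = β ^ 2 + 1) :
    ∃ C : ℝ, 0 ≤ C ∧ ∀ j x, 0 ≤ x → x ≤ 1 →
      |radicalSum G β j (indicatorLT x) - x * G j| ≤ C * (j + 1) := by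
  obtain ⟨U, hU⟩ := exists_abs_sub_mul_le hs hβ hroot
  have hU0 : 0 ≤ U := (abs_nonneg _).trans (hU 0)
  have hb : 0 < β := by positivity
  have hU2 : ∀ j, |(G j : ℝ) - β ^ 2 * G (j - 2)| ≤ U + β * U + 2 + β ^ 2 := by
    intro j
    match j with
    | 0 =>
      simp only [Nat.zero_sub, h0, Nat.cast_one, mul_one]
      rw [abs_le]; constructor <;> nlinarith [mul_nonneg hb.le hU0]
    | 1 =>
      have : G 1 = 2 := by rw [show (1 : ℕ) = 0 + 1 by rfl, hs 0]; simp [h0]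
      simp only [Nat.reduceSub, h0, this, Nat.cast_one, mul_one, Nat.cast_ofNat]
      rw [abs_le]; constructor <;> nlinarith [mul_nonneg hb.le hU0]
    | k + 2 =>
      simp only [show k + 2 - 2 = k by omega]
      have h1 := abs_le.1 (hU (k + 1))
      have h2 := abs_le.1 (hU k)
      simp only [show k + 1 + 1 = k + 2 by rfl] at h1
      rw [abs_le]
      constructor <;>
      nlinarith [mul_le_mul_of_nonneg_left h2.1 hb.le, mul_le_mul_of_nonneg_left h2.2 hb.le]
  set C : ℝ := U + β * U + 2 + β ^ 2 with hC
  have hUC : U ≤ C := by rw [hC]; nlinarith [mul_nonneg hb.le hU0]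
  have hC1 : 1 ≤ C := by rw [hC]; nlinarith [mul_nonneg hb.le hU0]
  refine ⟨C, by linarith, fun j => ?_⟩
  induction j using Nat.strong_induction_on with
  | _ j ih =>
    intro x hx0 hx1
    match j with
    | 0 =>
      rw [radicalSum_zero h0, h0, indicatorLT]
      split_ifs <;> norm_num <;> rw [abs_le] <;> constructor <;> linarith
    | j + 1 =>
      rw [radicalSum_indicatorLT_succ h0 hs hβ]
      rcases le_or_gt (β * x) 1 with h | h
      · rw [radicalSum_indicatorLT_of_nonpos h0 hs hβ (j - 2) (by nlinarith), add_zero]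
        have h1 := abs_le.1 (ih j (by omega) (β * x) (by positivity) h)
        have h2 := abs_le.1 (hU j)
        push_cast
        rw [abs_le]
        constructor <;>
        nlinarith [mul_le_mul_of_nonneg_left h2.1 hx0, mul_le_mul_of_nonneg_left h2.2 hx0,
          mul_nonneg hU0 (sub_nonneg.2 hx1)]
      · rw [radicalSum_indicatorLT_of_one_lt h0 hs hβ hroot j h]
        have h1 := abs_le.1 (ih (j - 2) (by omega) (β ^ 3 * x - β ^ 2) (by nlinarith)
          (by nlinarith [pow_pos hb 3]))
        have h2 := abs_le.1 (hU2 j)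
        have h3 : ((j - 2 : ℕ) : ℝ) ≤ j := by exact_mod_cast Nat.sub_le j 2
        have h4 : C * (((j - 2 : ℕ) : ℝ) + 1) ≤ C * (j + 1) := by gcongr
        have h5 : (G j : ℝ) + (β ^ 3 * x - β ^ 2) * G (j - 2) - x * G (j + 1) =
            (1 - x) * (G j - β ^ 2 * G (j - 2)) := by
          rw [hs j, hroot]; push_cast; ring
        have hx1' := sub_nonneg.2 hx1
        push_cast at *
        rw [abs_le]
        constructor <;>
        nlinarith [mul_le_mul_of_nonneg_left h2.1 hx1', mul_le_mul_of_nonneg_left h2.2 hx1',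
          mul_nonneg (zero_le_one.trans hC1) hx0]

/-- A sum along a sequence that counts upwards and restarts at `0` only after complete blocks. -/
lemma abs_sum_restart_le {P : ℕ → Prop} (g : ℕ → ℝ) {δ : ℝ}
    (hg : ∀ y, P y → |∑ i ∈ Finset.range y, g i| ≤ δ * y) (x : ℕ → ℕ)
    (hx : ∀ n, x (n + 1) = x n + 1 ∨ (x (n + 1) = 0 ∧ P (x n + 1))) (N : ℕ) :
    |∑ n ∈ Finset.range N, g (x n) - ∑ i ∈ Finset.range (x N), g i
      + ∑ i ∈ Finset.range (x 0), g i| ≤ δ * (N - x N + x 0) := by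
  induction N with
  | zero => simp
  | succ N ih =>
    rw [Finset.sum_range_succ]
    rcases hx N with h | ⟨h, hP⟩
    · rw [h, Finset.sum_range_succ]
      push_cast
      convert ih using 2 <;> ring
    · rw [h]
      have h1 := abs_le.1 (hg _ hP)
      rw [Finset.sum_range_succ] at h1
      have h2 := abs_le.1 ih
      push_cast at *
      rw [abs_le, Finset.sum_range_zero]
      constructor <;> linarith [h1.1, h1.2, h2.1, h2.2]

include h0 hs in
lemma prefixValue_eq_of_max (e : KG G) {m i : ℕ} (hmi : m ≤ i)
    (hi : prefixValue G e.val i + 1 = G i) :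
    ∃ j, m - 2 ≤ j ∧ j ≤ m ∧ prefixValue G e.val m + 1 = G j := by
  have hm := mono_of_recurrence hs
  refine Nat.decreasingInduction'
    (P := fun m => ∃ j, m - 2 ≤ j ∧ j ≤ m ∧ prefixValue G e.val m + 1 = G j)
    (fun k _ _ ⟨j, hj1, hj2, hj⟩ => ?_) hmi ⟨i, by omega, le_rfl, hi⟩
  have h1 := prefixValue_lt h0 e k
  have h2 := pos_of_recurrence h0 hs (k - 2)
  have h3 := hs k
  rcases Nat.lt_or_ge k j with hkj | hkj
  · obtain rfl : j = k + 1 := by omega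
    rcases digit_cases h0 hs e k with ⟨_, h⟩ | ⟨_, h⟩
    · omega
    · exact ⟨k - 2, le_rfl, by omega, by omega⟩
  · have h4 := hm hkj
    rcases digit_cases h0 hs e k with ⟨_, h⟩ | ⟨_, h⟩
    · exact ⟨j, by omega, hkj, by omega⟩
    · omega

include h0 hs in
lemma prefixValue_odometer_of_lt {τ : KG G → KG G} (hτ : IsOdometer G τ) (e : KG G) {j : ℕ}
    (hj : ∀ i, j ≤ i → prefixValue G e.val i < G i - 1) :
    prefixValue G (τ e).val j = prefixValue G e.val j + 1 := by
  have hm := mono_of_recurrence hs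
  match j with
  | 0 => have := hj 0 le_rfl; omega
  | j + 1 =>
    have hj' : ∀ i, j ≤ i → ∑ k ∈ Finset.range (i + 1), e.val k * G k < G (i + 1) - 1 :=
      fun i hi => hj (i + 1) (by omega)
    obtain ⟨⟨e', ⟨⟨K, hK0, hK⟩, -⟩, he'⟩, -⟩ := (hτ e).1 ⟨j, hj'⟩ j hj'
    have hlt := hj (j + 1) le_rfl
    change _ = prefixValue G e.val (j + 1) + 1 at hK
    have hzero : ∀ k, j + 1 ≤ k → e' k = 0 := by
      intro k hk
      by_contra hne
      have hkK : k < K := by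
        by_contra! h
        exact hne (hK0 k h)
      have h1 : e' k * G k ≤ ∑ k ∈ Finset.range K, e' k * G k :=
        Finset.single_le_sum (f := fun k => e' k * G k) (fun _ _ => Nat.zero_le _)
          (Finset.mem_range.2 hkK)
      have h2 := hm hk
      have h3 : G k ≤ e' k * G k := Nat.le_mul_of_pos_left _ (by omega)
      omega
    have h1 : prefixValue G (τ e).val (j + 1) = prefixValue G e' (j + 1) :=
      Finset.sum_congr rfl fun k hk => by
        rw [he' k (by rw [Finset.mem_range] at hk; omega)]
    rw [h1, ← hK]
    unfold prefixValue
    rcases le_total K (j + 1) with h | h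
    · refine (Finset.sum_subset (Finset.range_mono h) fun k _ hk => ?_).symm
      rw [Finset.mem_range, not_lt] at hk
      rw [hK0 k hk, zero_mul]
    · refine Finset.sum_subset (Finset.range_mono h) fun k _ hk => ?_
      rw [Finset.mem_range, not_lt] at hk
      rw [hzero k hk, zero_mul]

include h0 hs in
/-- The odometer increments the value of the first `m` digits, or resets it to zero. -/
lemma prefixValue_odometer {τ : KG G → KG G} (hτ : IsOdometer G τ) (e : KG G) (m : ℕ) :
    prefixValue G (τ e).val m = prefixValue G e.val m + 1 ∨
    (prefixValue G (τ e).val m = 0 ∧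
      ∃ j, m - 2 ≤ j ∧ j ≤ m ∧ prefixValue G e.val m + 1 = G j) := by
  have hm := mono_of_recurrence hs
  have hmax : ∀ i, ¬ prefixValue G e.val i < G i - 1 → prefixValue G e.val i + 1 = G i := by
    intro i hi
    have := prefixValue_lt h0 e i
    omega
  by_cases he : MemKG0 G e.val
  · have hex : ∃ j, ∀ i, j ≤ i → prefixValue G e.val i < G i - 1 := by
      obtain ⟨M, hM⟩ := he
      refine ⟨M + 1, fun i hi => ?_⟩
      obtain ⟨i, rfl⟩ : ∃ i', i = i' + 1 := ⟨i - 1, by omega⟩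
      exact hM i (by omega)
    classical
    have hspec := Nat.find_spec hex
    rcases le_or_gt (Nat.find hex) m with hjm | hjm
    · exact Or.inl (prefixValue_odometer_of_lt h0 hs hτ e fun i hi => hspec i (hjm.trans hi))
    · obtain ⟨j, hj⟩ : ∃ j, Nat.find hex = j + 1 := ⟨Nat.find hex - 1, by omega⟩
      rw [hj] at hspec
      have hnot := Nat.find_min hex (m := j) (by omega)
      have hjeq : prefixValue G e.val j + 1 = G j := by
        apply hmax
        intro hlt
        refine hnot fun i hi => ?_
        rcases Nat.eq_or_lt_of_le hi with rfl | hi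
        · exact hlt
        · exact hspec i hi
      right
      refine ⟨?_, prefixValue_eq_of_max h0 hs e (by omega : m ≤ j) hjeq⟩
      have h1 := prefixValue_odometer_of_lt h0 hs hτ e hspec
      have h2 := hspec (j + 1) le_rfl
      have h3 := hs j
      have h4 := hm (Nat.sub_le j 2)
      have h5 := prefixValue_lt h0 (τ e) j
      have h6 := prefixValue_mono (G := G) (τ e).val (by omega : m ≤ j)
      rcases digit_cases h0 hs e j with ⟨_, h⟩ | ⟨_, h⟩ <;>
      rcases digit_cases h0 hs (τ e) j with ⟨_, h'⟩ | ⟨_, h'⟩ <;> omega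
  · right
    refine ⟨Finset.sum_eq_zero fun k _ => by rw [(hτ e).2 he k, zero_mul], ?_⟩
    simp only [MemKG0, not_exists, not_forall] at he
    obtain ⟨i, hi, hlt⟩ := he m
    exact prefixValue_eq_of_max h0 hs e (by omega : m ≤ i + 1) (hmax _ hlt)

include h0 hs in
lemma monna_mem_Icc {β : ℝ} (hβ : 1 < β) (e : KG G) (m : ℕ) :
    radicalInverse G β m (prefixValue G e.val m) ≤ monna β e.val ∧
    monna β e.val ≤ radicalInverse G β m (prefixValue G e.val m) + (1 / β) ^ m / (β - 1) := by
  have hb : 0 < β := by positivity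
  have hr : 1 / β < 1 := by rw [div_lt_one hb]; exact hβ
  have hd : ∀ k, (e.val k : ℝ) / β ^ (k + 1) ≤ 1 / β * (1 / β) ^ k := by
    intro k
    have : (e.val k : ℝ) ≤ 1 := by exact_mod_cast digit_le_one h0 hs e k
    rw [← pow_succ', one_div_pow]
    gcongr
  have hn : ∀ k, 0 ≤ (e.val k : ℝ) / β ^ (k + 1) := fun k => by positivity
  have hgeo := (summable_geometric_of_lt_one (by positivity) hr).mul_left (1 / β)
  have hsum := Summable.of_nonneg_of_le hn hd hgeo
  rw [radicalInverse_prefixValue h0 hs, monna, ← hsum.sum_add_tsum_nat_add m]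
  refine ⟨le_add_of_nonneg_right (tsum_nonneg fun k => hn _), ?_⟩
  gcongr
  have h1 : ∑' k, 1 / β * (1 / β) ^ (k + m) = (1 / β) ^ m / (β - 1) := by
    simp_rw [pow_add, ← mul_assoc]
    rw [tsum_mul_right, tsum_mul_left, tsum_geometric_of_lt_one (by positivity) hr]
    have : β - 1 ≠ 0 := by linarith
    field_simp
  rw [← h1]
  exact ((summable_nat_add_iff m).2 hsum).tsum_le_tsum (fun k => hd _)
    ((summable_nat_add_iff m).2 hgeo)

include h0 hs in
lemma exists_abs_sum_radicalInverse_le {β : ℝ} {τ : KG G → KG G} (hτ : IsOdometer G τ)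
    (e : KG G) {δ : ℝ} {m : ℕ} (hδ : 0 ≤ δ)
    (hm : ∀ j x, m - 2 ≤ j → 0 ≤ x → x ≤ 1 →
      |radicalSum G β j (indicatorLT x) - x * G j| ≤ δ * G j) {x : ℝ} (hx0 : 0 ≤ x) (hx1 : x ≤ 1) :
    ∃ K : ℝ, ∀ N : ℕ, |∑ n ∈ Finset.range N, indicatorLT x
        (radicalInverse G β m (prefixValue G (τ^[n] e).val m)) - x * N| ≤ δ * N + K := by
  set g : ℕ → ℝ := fun i => indicatorLT x (radicalInverse G β m i) - x with hgdef
  have hg1 : ∀ i, |g i| ≤ 1 := by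
    intro i
    simp only [hgdef, indicatorLT]
    split_ifs <;> rw [abs_le] <;> constructor <;> linarith
  have hgsum : ∀ y, |∑ i ∈ Finset.range y, g i| ≤ y := by
    intro y
    refine (Finset.abs_sum_le_sum_abs _ _).trans ((Finset.sum_le_sum fun i _ => hg1 i).trans ?_)
    simp
  have hblock : ∀ y, (∃ j, m - 2 ≤ j ∧ j ≤ m ∧ y = G j) →
      |∑ i ∈ Finset.range y, g i| ≤ δ * y := by
    rintro _ ⟨j, hj1, hj2, rfl⟩
    have h1 : ∑ i ∈ Finset.range (G j), g i =
        radicalSum G β j (indicatorLT x) - x * G j := by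
      simp only [hgdef, Finset.sum_sub_distrib, radicalSum, Finset.sum_const, Finset.card_range,
        nsmul_eq_mul, mul_comm x]
      congr 1
      refine Finset.sum_congr rfl fun i hi => ?_
      rw [radicalInverse_eq_of_le β (mono_of_recurrence hs) hj2 (Finset.mem_range.1 hi)]
    rw [h1]
    exact hm j x hj1 hx0 hx1
  refine ⟨(2 + δ) * G m, fun N => ?_⟩
  have key := abs_sum_restart_le g hblock (fun n => prefixValue G (τ^[n] e).val m)
    (fun n => by
      rw [Function.iterate_succ_apply']
      exact prefixValue_odometer h0 hs hτ (τ^[n] e) m) N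
  have hlt : ∀ n, (prefixValue G (τ^[n] e).val m : ℝ) ≤ G m := fun n => by
    exact_mod_cast (prefixValue_lt h0 (τ^[n] e) m).le
  have hsum : ∑ n ∈ Finset.range N, g (prefixValue G (τ^[n] e).val m) =
      ∑ n ∈ Finset.range N, indicatorLT x
        (radicalInverse G β m (prefixValue G (τ^[n] e).val m)) - x * N := by
    simp [hgdef, mul_comm]
  rw [← hsum]
  have h1 := abs_le.1 key
  have h2 := abs_le.1 (hgsum (prefixValue G (τ^[N] e).val m))
  have h3 := abs_le.1 (hgsum (prefixValue G (τ^[0] e).val m))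
  have h4 := hlt N
  have h5 := hlt 0
  have h6 : (0 : ℝ) ≤ prefixValue G (τ^[N] e).val m := Nat.cast_nonneg _
  have h7 := mul_le_mul_of_nonneg_left h5 hδ
  have h8 := mul_nonneg hδ h6
  rw [abs_le]
  constructor <;> linarith [h1.1, h1.2, h2.1, h2.2, h3.1, h3.2]

include h0 hs in
lemma exists_forall_discrepancy_le {β : ℝ} (hβ : 1 < β) (hroot : β ^ 3 = β ^ 2 + 1) {δ : ℝ}
    (hδ : 0 < δ) : ∃ m : ℕ, (1 / β) ^ m / (β - 1) ≤ δ ∧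
      ∀ j x, m - 2 ≤ j → 0 ≤ x → x ≤ 1 →
        |radicalSum G β j (indicatorLT x) - x * G j| ≤ δ * G j := by
  obtain ⟨C, hC0, hC⟩ := exists_discrepancy_le h0 hs hβ hroot
  have hb1 : 0 < β - 1 := sub_pos.2 hβ
  obtain ⟨M, hM⟩ := exists_nat_ge (10 * C / δ)
  obtain ⟨L, hL⟩ := exists_pow_lt_of_lt_one (mul_pos hδ hb1)
    (show 1 / β < 1 by rw [div_lt_one (by positivity)]; exact hβ)
  refine ⟨max L (M + 2), ?_, fun j x hj hx0 hx1 => (hC j x hx0 hx1).trans ?_⟩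
  · rw [div_le_iff₀ hb1]
    refine le_trans ?_ hL.le
    exact pow_le_pow_of_le_one (by positivity)
      (by rw [div_le_one (by positivity)]; exact hβ.le) (le_max_left _ _)
  · have hMj : (M : ℝ) ≤ j := by
      have : M ≤ j := by have := le_max_right L (M + 2); omega
      exact_mod_cast this
    rw [div_le_iff₀ hδ] at hM
    have h1 : ((j : ℝ) + 1) ^ 2 ≤ 10 * G j := by exact_mod_cast sq_le_of_recurrence h0 hs j
    have hj0 : (0 : ℝ) ≤ j := Nat.cast_nonneg j
    have h2 : 10 * C ≤ (j + 1) * δ := by nlinarith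
    nlinarith [mul_le_mul_of_nonneg_right h2 (by positivity : (0 : ℝ) ≤ j + 1)]

include h0 hs in
lemma tendsto_freq_monna_lt {β : ℝ} (hβ : 1 < β) (hroot : β ^ 3 = β ^ 2 + 1)
    {τ : KG G → KG G} (hτ : IsOdometer G τ) (e : KG G) {x : ℝ} (hx0 : 0 ≤ x) (hx1 : x ≤ 1) :
    Tendsto (fun N : ℕ =>
      (∑ n ∈ Finset.range N, indicatorLT x (monna β (τ^[n] e).val)) / (N : ℝ)) atTop (nhds x) := by
  rw [Metric.tendsto_atTop]
  intro ε hε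
  obtain ⟨m, hmδ, hm⟩ := exists_forall_discrepancy_le h0 hs hβ hroot (δ := ε / 4) (by positivity)
  obtain ⟨K, hK⟩ : ∃ K : ℝ, ∀ N : ℕ,
      |∑ n ∈ Finset.range N, indicatorLT x (monna β (τ^[n] e).val) - x * N| ≤
        ε / 2 * N + K := by
    obtain ⟨K₁, hK₁⟩ := exists_abs_sum_radicalInverse_le h0 hs hτ e
      (by positivity) hm hx0 hx1
    have hup : ∀ N : ℕ, ∑ n ∈ Finset.range N, indicatorLT x (monna β (τ^[n] e).val) ≤
        ∑ n ∈ Finset.range N, indicatorLT x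
          (radicalInverse G β m (prefixValue G (τ^[n] e).val m)) := fun N =>
      Finset.sum_le_sum fun n _ => by
        have := (monna_mem_Icc h0 hs hβ (τ^[n] e) m).1
        unfold indicatorLT
        split_ifs <;> linarith
    have hK₁' : 0 ≤ K₁ := by have := (abs_nonneg _).trans (hK₁ 0); simpa using this
    rcases le_or_gt (ε / 4) x with hxε | hxε
    · obtain ⟨K₂, hK₂⟩ := exists_abs_sum_radicalInverse_le h0 hs hτ e
        (by positivity) hm (x := x - ε / 4) (by linarith) (by linarith)
      have hK₂' : 0 ≤ K₂ := by have := (abs_nonneg _).trans (hK₂ 0); simpa using this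
      refine ⟨K₁ + K₂, fun N => ?_⟩
      have hlow : ∑ n ∈ Finset.range N, indicatorLT (x - ε / 4)
          (radicalInverse G β m (prefixValue G (τ^[n] e).val m)) ≤
          ∑ n ∈ Finset.range N, indicatorLT x (monna β (τ^[n] e).val) :=
        Finset.sum_le_sum fun n _ => by
          have := (monna_mem_Icc h0 hs hβ (τ^[n] e) m).2
          unfold indicatorLT
          split_ifs <;> linarith
      have h1 := abs_le.1 (hK₁ N)
      have h2 := abs_le.1 (hK₂ N)
      have h3 := hup N
      have h4 : 0 ≤ ε * N := by positivity
      rw [abs_le]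
      constructor <;> nlinarith [h1.2, h2.1]
    · refine ⟨K₁, fun N => ?_⟩
      have h1 := abs_le.1 (hK₁ N)
      have h3 := hup N
      have h4 : 0 ≤ ε * N := by positivity
      have h5 : 0 ≤ ∑ n ∈ Finset.range N, indicatorLT x (monna β (τ^[n] e).val) :=
        Finset.sum_nonneg fun n _ => by unfold indicatorLT; split_ifs <;> norm_num
      have h6 : x * N ≤ ε / 4 * N := by gcongr
      rw [abs_le]
      constructor <;> linarith [h1.2]
  obtain ⟨N₀, hN₀⟩ := exists_nat_gt (2 * K / ε)
  refine ⟨N₀ + 1, fun N hN => ?_⟩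
  have hN1 : (N₀ : ℝ) + 1 ≤ N := by exact_mod_cast hN
  have hNpos : (0 : ℝ) < N := by have : (0 : ℝ) ≤ N₀ := Nat.cast_nonneg _; linarith
  have h2 : 2 * K < ε * N := by
    rw [div_lt_iff₀ hε] at hN₀
    nlinarith
  rw [Real.dist_eq]
  have h3 : ∀ S : ℝ, S / N - x = (S - x * N) / N := fun S => by field_simp
  rw [h3, abs_div, abs_of_pos hNpos, div_lt_iff₀ hNpos]
  linarith [hK N]

end Recurrence

/-- For the numeration system `G₀ = 1, G₁ = 2, G₂ = 3, G_{n+3} = G_{n+2} + G_n`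
with root `β > 1` of `β³ = β² + 1` and odometer `τ`, for every `e ∈ K_G` the
sequence `(φ_β(τⁿ e))_{n ≥ 0}` is uniformly distributed in `[0,1)`. -/
theorem orbit_ud_101 (G : ℕ → ℕ)
    (hG : G 0 = 1 ∧ G 1 = 2 ∧ G 2 = 3 ∧ ∀ n, G (n + 3) = G (n + 2) + G n)
    (β : ℝ) (hβ : 1 < β) (hroot : β ^ 3 = β ^ 2 + 1)
    (τ : KG G → KG G) (hτ : IsOdometer G τ) :
    ∀ e : KG G, IsUDZero (fun n => monna β ((τ^[n]) e).val) := by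
  intro e a b ha hab hb
  obtain ⟨h0, h1, h2, h3⟩ := hG
  have hs : ∀ n, G (n + 1) = G n + G (n - 2) := by
    intro n
    match n with
    | 0 => simp [h0, h1]
    | 1 => simp [h0, h1, h2]
    | n + 2 => exact h3 n
  have hA := tendsto_freq_monna_lt h0 hs hβ hroot hτ e ha (hab.trans hb)
  have hB := tendsto_freq_monna_lt h0 hs hβ hroot hτ e (ha.trans hab) hb
  refine (hB.sub hA).congr fun N => ?_
  rw [← sub_div, ← Finset.sum_sub_distrib]
  congr 1
  refine Finset.sum_congr rfl fun n _ => ?_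
  simp only [indicatorLT, Set.indicator, Set.mem_Ico]
  grind
end

section
/- Let G be the Fibonacci numeration system, i.e., G_0 = 1, G_1 = 2 and G_{n+2} = G_{n+1} + G_n for n ≥ 0, let β = (1+√5)/2 be the golden ratio, and let τ be the odometer on the space K_G of G-admissible digit sequences. Then for every ε ∈ K_G the sequence (φ_β(τ^n ε))_{n≥0} is uniformly distributed in [0,1); that is, the Kakutani–Fibonacci transformation T = φ_β ∘ τ ∘ φ_β^+ is uniquely ergodic and every one of its orbits is uniformly distributed. -/
open MeasureTheory Filter

section Counting

open Real
open scoped goldenRatio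

/-- The number of values `∑_{k < m} w k / φ ^ (k + 1)` below `x`, as `w` runs over the admissible
words of length `m`, is `fibCount (m + 2) x`. The recursion splits words by their last digit. -/
noncomputable def fibCount : ℕ → ℝ → ℝ
  | 0, _ => 0
  | 1, x => if 0 < x then 1 else 0
  | m + 2, x => fibCount (m + 1) x + fibCount m (x - (φ ^ m)⁻¹)

lemma fibCount_add_two (m : ℕ) (x : ℝ) :
    fibCount (m + 2) x = fibCount (m + 1) x + fibCount m (x - (φ ^ m)⁻¹) := rfl

/-- Splitting words by their first digit instead of their last one. -/
lemma fibCount_add_two_first (m : ℕ) (x : ℝ) :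
    fibCount (m + 2) x = fibCount (m + 1) (φ * x) + fibCount m (φ ^ 2 * x - φ) := by
  have hφ := goldenRatio_pos
  have hsq := goldenRatio_sq
  induction m using Nat.twoStepInduction generalizing x with
  | zero => simp [fibCount, hφ]
  | one =>
    have h : 0 < x - φ⁻¹ ↔ 0 < φ ^ 2 * x - φ := by
      have : φ ^ 2 * x - φ = φ ^ 2 * (x - φ⁻¹) := by field_simp
      rw [this, mul_pos_iff_of_pos_left (by positivity)]
    simp only [fibCount, pow_one, mul_pos_iff_of_pos_left hφ, h]
  | more m ih₀ ih₁ =>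
    rw [fibCount_add_two (m + 2), ih₁ x, ih₀ (x - _), fibCount_add_two (m + 1) (φ * x),
      fibCount_add_two m (φ ^ 2 * x - φ)]
    have h₁ : φ * (x - (φ ^ (m + 2))⁻¹) = φ * x - (φ ^ (m + 1))⁻¹ := by
      generalize φ = t at hφ ⊢
      field_simp
      ring
    have h₂ : φ ^ 2 * (x - (φ ^ (m + 2))⁻¹) - φ = φ ^ 2 * x - φ - (φ ^ m)⁻¹ := by
      have : φ ^ 2 * (φ ^ (m + 2))⁻¹ = (φ ^ m)⁻¹ := by
        generalize φ = t at hφ ⊢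
        field_simp
        ring
      linear_combination -this
    rw [h₁, h₂]
    ring

lemma fibCount_of_nonpos (m : ℕ) {x : ℝ} (hx : x ≤ 0) : fibCount m x = 0 := by
  induction m using Nat.twoStepInduction generalizing x with
  | zero => rfl
  | one => simp [fibCount, hx]
  | more m ih₀ ih₁ =>
    have : 0 < (φ ^ m)⁻¹ := by have := goldenRatio_pos; positivity
    rw [fibCount_add_two, ih₁ hx, ih₀ (by linarith), add_zero]

lemma fibCount_of_one_le (m : ℕ) {x : ℝ} (hx : 1 ≤ x) : fibCount m x = Nat.fib m := by
  induction m using Nat.twoStepInduction generalizing x with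
  | zero => simp [fibCount]
  | one => simp [fibCount, zero_lt_one.trans_le hx]
  | more m ih₀ ih₁ =>
    have h1 := one_lt_goldenRatio
    have hsq := goldenRatio_sq
    rw [fibCount_add_two_first, ih₁ (by nlinarith), ih₀ (by rw [hsq]; nlinarith), Nat.fib_add_two]
    push_cast
    ring

lemma abs_goldenConj_pow_le_one (m : ℕ) : |ψ ^ m| ≤ 1 := by
  rw [abs_pow]
  exact pow_le_one₀ (abs_nonneg _)
    (abs_le.2 ⟨neg_one_lt_goldenConj.le, goldenConj_neg.le.trans zero_le_one⟩)

lemma abs_fibCount_sub_le (m : ℕ) {x : ℝ} (hx₀ : 0 ≤ x) (hx₁ : x ≤ 1) :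
    |fibCount m x - x * Nat.fib m| ≤ m := by
  induction m using Nat.twoStepInduction generalizing x with
  | zero => simp [fibCount]
  | one =>
    simp only [fibCount, Nat.fib_one, Nat.cast_one, mul_one]
    split_ifs <;> rw [abs_le] <;> constructor <;> linarith
  | more m ih₀ ih₁ =>
    have h1 := one_lt_goldenRatio
    have hsq := goldenRatio_sq
    have hfib : (Nat.fib (m + 2) : ℝ) = Nat.fib m + Nat.fib (m + 1) := by
      rw [Nat.fib_add_two]; push_cast; ring
    have hψ : (Nat.fib (m + 1) : ℝ) - φ * Nat.fib m = ψ ^ m :=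
      fib_succ_sub_goldenRatio_mul_fib m
    have hψ' : (Nat.fib (m + 2) : ℝ) - φ * Nat.fib (m + 1) = ψ ^ (m + 1) :=
      fib_succ_sub_goldenRatio_mul_fib (m + 1)
    rw [fibCount_add_two_first]
    rcases le_total (φ * x) 1 with h | h
    · rw [fibCount_of_nonpos m (x := φ ^ 2 * x - φ) (by nlinarith)]
      have key : fibCount (m + 1) (φ * x) + 0 - x * Nat.fib (m + 2)
          = (fibCount (m + 1) (φ * x) - φ * x * Nat.fib (m + 1)) + -(x * ψ ^ (m + 1)) := by
        rw [← hψ']; ring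
      rw [key]
      refine (abs_add_le _ _).trans ?_
      have h₁ := ih₁ (x := φ * x) (by positivity) h
      have h₂ : |-(x * ψ ^ (m + 1))| ≤ 1 := by
        rw [abs_neg, abs_mul, abs_of_nonneg hx₀]
        exact mul_le_one₀ hx₁ (abs_nonneg _) (abs_goldenConj_pow_le_one _)
      push_cast at h₁ ⊢
      linarith
    · rw [fibCount_of_one_le (m + 1) h]
      have key : (Nat.fib (m + 1) : ℝ) + fibCount m (φ ^ 2 * x - φ) - x * Nat.fib (m + 2)
          = (fibCount m (φ ^ 2 * x - φ) - (φ ^ 2 * x - φ) * Nat.fib m) + (1 - x) * ψ ^ m := by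
        rw [← hψ, hfib]
        linear_combination (x * Nat.fib m) * hsq
      rw [key]
      refine (abs_add_le _ _).trans ?_
      have h₁ := ih₀ (x := φ ^ 2 * x - φ) (by nlinarith) (by nlinarith)
      have h₂ : |(1 - x) * ψ ^ m| ≤ 1 := by
        rw [abs_mul, abs_of_nonneg (sub_nonneg.2 hx₁)]
        exact mul_le_one₀ (by linarith) (abs_nonneg _) (abs_goldenConj_pow_le_one _)
      push_cast
      linarith

lemma abs_fibCount_shift_sub_le (m : ℕ) {x s : ℝ} (hx₀ : 0 ≤ x) (hx₁ : x ≤ 1) (hs : 0 ≤ s) :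
    |fibCount m (x - s) - x * Nat.fib m| ≤ m + s * Nat.fib m := by
  have hF : (0 : ℝ) ≤ Nat.fib m := Nat.cast_nonneg _
  have hm : (0 : ℝ) ≤ m := Nat.cast_nonneg _
  rcases le_total (x - s) 0 with h | h
  · rw [fibCount_of_nonpos m h, zero_sub, abs_neg, abs_of_nonneg (by positivity)]
    nlinarith
  · have key : fibCount m (x - s) - x * Nat.fib m
        = (fibCount m (x - s) - (x - s) * Nat.fib m) + -(s * Nat.fib m) := by ring
    rw [key]
    refine (abs_add_le _ _).trans (add_le_add (abs_fibCount_sub_le m h (by linarith)) ?_)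
    rw [abs_neg, abs_of_nonneg (by positivity)]

lemma fib_le_goldenRatio_pow (m : ℕ) : (Nat.fib (m + 1) : ℝ) ≤ φ ^ m := by
  have h := fib_succ_sub_goldenConj_mul_fib m
  have : (0 : ℝ) ≤ Nat.fib m := Nat.cast_nonneg _
  nlinarith [goldenConj_neg]

end Counting

section Admissible

/-- The value `∑_{k < M} e k * G k` of the first `M` digits of `e`. -/
def partialValue (G e : ℕ → ℕ) (M : ℕ) : ℕ := ∑ k ∈ Finset.range M, e k * G k

lemma partialValue_succ (G e : ℕ → ℕ) (M : ℕ) :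
    partialValue G e (M + 1) = partialValue G e M + e M * G M :=
  Finset.sum_range_succ _ _

lemma partialValue_mono (G e : ℕ → ℕ) : Monotone (partialValue G e) :=
  monotone_nat_of_le_succ fun n => by rw [partialValue_succ]; omega

lemma partialValue_congr {G e e' : ℕ → ℕ} {M : ℕ} (h : ∀ k, k < M → e k = e' k) :
    partialValue G e M = partialValue G e' M :=
  Finset.sum_congr rfl fun k hk => by rw [h k (Finset.mem_range.1 hk)]

variable {G : ℕ → ℕ}

lemma partialValue_eq_zero (hpos : ∀ n, 0 < G n) {e : ℕ → ℕ} {M k : ℕ}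
    (h : partialValue G e M = 0) (hk : k < M) : e k = 0 := by
  have := Finset.sum_eq_zero_iff.1 h k (Finset.mem_range.2 hk)
  exact (Nat.mul_eq_zero.1 this).resolve_right (hpos k).ne'

/-- `G` is the Fibonacci numeration system. -/
structure IsFibSystem (G : ℕ → ℕ) : Prop where
  zero : G 0 = 1
  one : G 1 = 2
  add_two : ∀ n, G (n + 2) = G (n + 1) + G n

namespace IsFibSystem

lemma eq_fib (hG : IsFibSystem G) (n : ℕ) : G n = Nat.fib (n + 2) := by
  induction n using Nat.twoStepInduction with
  | zero => exact hG.zero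
  | one => exact hG.one
  | more n ih₀ ih₁ => rw [hG.add_two, ih₀, ih₁, Nat.fib_add_two (n := n + 2), add_comm]

lemma pos (hG : IsFibSystem G) (n : ℕ) : 0 < G n := by
  rw [hG.eq_fib, Nat.fib_pos]; omega

lemma strictMono (hG : IsFibSystem G) : StrictMono G := by
  have : G = fun n => Nat.fib (n + 2) := funext hG.eq_fib
  exact this ▸ Nat.fib_add_two_strictMono

lemma succ_le_two_mul (hG : IsFibSystem G) (n : ℕ) : G (n + 1) ≤ 2 * G n := by
  cases n with
  | zero => simp [hG.zero, hG.one]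
  | succ n =>
    have := hG.strictMono n.lt_add_one
    rw [hG.add_two]
    omega

lemma partialValue_lt (hG : IsFibSystem G) (e : KG G) (M : ℕ) : partialValue G e.val M < G M := by
  cases M with
  | zero => simpa [partialValue] using hG.pos 0
  | succ M => exact e.2 (M + 1) (by omega)

lemma digit_le_one (hG : IsFibSystem G) (e : KG G) (k : ℕ) : e.val k ≤ 1 := by
  have h := hG.partialValue_lt e (k + 1)
  have h2 := hG.succ_le_two_mul k
  rw [partialValue_succ] at h
  by_contra! hc
  nlinarith [Nat.mul_le_mul_right (G k) hc]

lemma digit_eq_zero_or_one (hG : IsFibSystem G) (e : KG G) (k : ℕ) :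
    e.val k = 0 ∨ e.val k = 1 := by
  have := hG.digit_le_one e k
  omega

lemma partialValue_add_one_lt (hG : IsFibSystem G) (e : KG G) {M : ℕ}
    (h₀ : partialValue G e.val M + 1 < G M) (h₁ : partialValue G e.val (M + 1) + 1 < G (M + 1))
    {i : ℕ} (hi : M ≤ i) : partialValue G e.val i + 1 < G i := by
  suffices h : partialValue G e.val i + 1 < G i ∧ partialValue G e.val (i + 1) + 1 < G (i + 1) from
    h.1
  induction i, hi using Nat.le_induction with
  | base => exact ⟨h₀, h₁⟩
  | succ i _ ih =>
    refine ⟨ih.2, ?_⟩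
    have hlt := hG.partialValue_lt e (i + 1 + 1)
    have hs₀ := partialValue_succ G e.val i
    have hs₁ := partialValue_succ G e.val (i + 1)
    have hr : G (i + 1 + 1) = G (i + 1) + G i := hG.add_two i
    have hm := hG.strictMono (i + 1).lt_add_one
    rcases hG.digit_eq_zero_or_one e (i + 1) with h | h <;>
    rcases hG.digit_eq_zero_or_one e i with h' | h' <;>
    simp only [h, h', zero_mul, one_mul] at hs₀ hs₁ <;> omega

end IsFibSystem

variable {τ : KG G → KG G}

lemma IsOdometer.partialValue_apply (hτ : IsOdometer G τ) (hG : IsFibSystem G) (e : KG G) {j : ℕ}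
    (h : ∀ i, j < i → partialValue G e.val i + 1 < G i) :
    partialValue G (τ e).val (j + 1) = partialValue G e.val (j + 1) + 1 ∧
      ∀ i, j < i → (τ e).val i = e.val i := by
  have h' : ∀ i, j ≤ i → ∑ k ∈ Finset.range (i + 1), e.val k * G k < G (i + 1) - 1 := by
    intro i hi
    have := h (i + 1) (by omega)
    unfold partialValue at this
    omega
  obtain ⟨⟨e', ⟨⟨K, hK, hsum⟩, -⟩, he'⟩, hhigh⟩ := (hτ e).1 ⟨j, h'⟩ j h'
  refine ⟨?_, hhigh⟩
  have hlt := h (j + 1) (by omega)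
  change partialValue G e' K = partialValue G e.val (j + 1) + 1 at hsum
  rw [partialValue_congr (e' := e') fun k hk => he' k (by omega), ← hsum]
  have hz : ∀ i, j < i → e' i = 0 := by
    intro i hi
    by_contra hne
    have hiK : i < K := by
      by_contra! hc
      exact hne (hK i hc)
    have h₁ := partialValue_mono G e' hiK
    simp only [Nat.succ_eq_add_one] at h₁
    rw [partialValue_succ] at h₁
    have h₂ : G (j + 1) ≤ G i := hG.strictMono.monotone hi
    have h₃ : G i ≤ e' i * G i := Nat.le_mul_of_pos_left _ (by omega)
    omega
  rcases le_total K (j + 1) with hle | hle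
  · exact (Finset.sum_subset (Finset.range_mono hle) fun k _ hk => by
      rw [hK k (by simpa using hk), zero_mul]).symm
  · exact Finset.sum_subset (Finset.range_mono hle) fun k _ hk => by
      rw [hz k (by simpa using hk), zero_mul]

lemma IsOdometer.step (hτ : IsOdometer G τ) (hG : IsFibSystem G) (e : KG G) {M : ℕ}
    (h₀ : partialValue G e.val M + 1 < G M) (h₁ : partialValue G e.val (M + 1) + 1 < G (M + 1)) :
    partialValue G (τ e).val M = partialValue G e.val M + 1 ∧
      ∀ i, M ≤ i → (τ e).val i = e.val i := by
  cases M with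
  | zero => have := hG.zero; omega
  | succ j => exact hτ.partialValue_apply hG e fun i hi => hG.partialValue_add_one_lt e h₀ h₁ hi

lemma IsOdometer.carry (hτ : IsOdometer G τ) (hG : IsFibSystem G) (e : KG G) {M : ℕ}
    (h : ∃ i, M ≤ i ∧ ¬ partialValue G e.val i + 1 < G i) :
    partialValue G (τ e).val M = 0 := by
  by_cases hmem : MemKG0 G e.val
  · obtain ⟨j₀, hj₀⟩ := hmem
    set P : ℕ → Prop := fun i => ¬ partialValue G e.val i + 1 < G i
    have hgood : ∀ i, j₀ < i → ¬ P i := by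
      intro i hi hP
      obtain ⟨k, rfl⟩ : ∃ k, i = k + 1 := ⟨i - 1, by omega⟩
      have := hj₀ k (by omega)
      change partialValue G e.val (k + 1) < _ at this
      exact hP (by omega)
    obtain ⟨i, hMi, hi⟩ := h
    classical
    obtain ⟨J, hMJ, hJ, hmax⟩ : ∃ J, M ≤ J ∧ P J ∧ ∀ k, J < k → ¬ P k := by
      have hij : i ≤ j₀ := by
        by_contra! hc
        exact hgood i hc hi
      refine ⟨Nat.findGreatest P j₀, hMi.trans (Nat.le_findGreatest hij hi),
        Nat.findGreatest_spec hij hi, fun k hk => ?_⟩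
      by_cases hkj : k ≤ j₀
      · exact Nat.findGreatest_is_greatest hk hkj
      · exact hgood k (by omega)
    obtain ⟨hval, -⟩ := hτ.partialValue_apply hG e (j := J) fun k hk => not_not.1 (hmax k hk)
    have hJ' : ¬ partialValue G e.val J + 1 < G J := hJ
    have hJ₁ : partialValue G e.val (J + 1) + 1 < G (J + 1) := not_not.1 (hmax (J + 1) (by omega))
    have hlt := hG.partialValue_lt e J
    have hlt' := hG.partialValue_lt (τ e) J
    have h2 := hG.succ_le_two_mul J
    rw [partialValue_succ] at hval hJ₁
    rw [partialValue_succ] at hval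
    have hz : partialValue G (τ e).val J = 0 := by
      rcases hG.digit_eq_zero_or_one e J with h | h <;>
      rcases hG.digit_eq_zero_or_one (τ e) J with h' | h' <;>
      simp only [h, h', zero_mul, one_mul] at hval hJ₁ <;> omega
    exact Nat.le_zero.1 (hz ▸ partialValue_mono G (τ e).val hMJ)
  · exact Finset.sum_eq_zero fun k _ => by rw [(hτ e).2 hmem k, zero_mul]

lemma IsOdometer.iterate (hτ : IsOdometer G τ) (hG : IsFibSystem G) {e : KG G} {M : ℕ}
    (h₀ : partialValue G e.val M = 0) (h₁ : e.val M = 0) {n : ℕ} (hn : n < G M) :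
    partialValue G (τ^[n] e).val M = n ∧ ∀ i, M ≤ i → (τ^[n] e).val i = e.val i := by
  induction n with
  | zero => exact ⟨h₀, fun _ _ => rfl⟩
  | succ n ih =>
    obtain ⟨ih₁, ih₂⟩ := ih (by omega)
    have hM : G M < G (M + 1) := hG.strictMono M.lt_succ_self
    have := hτ.step hG (τ^[n] e) (M := M) (by omega)
      (by rw [partialValue_succ, ih₂ M le_rfl, h₁]; omega)
    rw [Function.iterate_succ_apply']
    exact ⟨by rw [this.1, ih₁], fun i hi => by rw [this.2 i hi, ih₂ i hi]⟩

lemma IsOdometer.iterate_raise (hτ : IsOdometer G τ) (hG : IsFibSystem G) {e : KG G} {k : ℕ}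
    (h₀ : partialValue G e.val (k + 1) = 0) (h₁ : e.val (k + 1) = 0) (i : ℕ) :
    (τ^[G k] e).val i = e.val i + if i = k then 1 else 0 := by
  obtain ⟨hv, hh⟩ := hτ.iterate hG h₀ h₁ (hG.strictMono k.lt_succ_self)
  have hlt := hG.partialValue_lt (τ^[G k] e) k
  have hpos := hG.pos k
  have hz := fun i hi => partialValue_eq_zero hG.pos (k := i) h₀ hi
  rw [partialValue_succ] at hv
  have hone : (τ^[G k] e).val k = 1 ∧ partialValue G (τ^[G k] e).val k = 0 := by
    rcases hG.digit_eq_zero_or_one (τ^[G k] e) k with h | h <;> rw [h] at hv ⊢ <;> omega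
  rcases lt_trichotomy i k with h | rfl | h
  · rw [if_neg h.ne, hz i (by omega), partialValue_eq_zero hG.pos hone.2 h]
  · rw [if_pos rfl, hz i (by omega), hone.1]
  · rw [if_neg h.ne', hh i h, add_zero]

end Admissible

section Orbit

open Real
open scoped goldenRatio

variable {G : ℕ → ℕ} {τ : KG G → KG G}

lemma summable_goldenRatio_inv_pow : Summable fun k : ℕ => (φ⁻¹) ^ (k + 1) :=
  (summable_nat_add_iff 1).2
    (summable_geometric_of_lt_one (inv_nonneg.2 goldenRatio_pos.le)
      (inv_lt_one_of_one_lt₀ one_lt_goldenRatio))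

lemma digit_div_le (hG : IsFibSystem G) (e : KG G) (k : ℕ) :
    (e.val k : ℝ) / φ ^ (k + 1) ≤ (φ⁻¹) ^ (k + 1) := by
  have : (e.val k : ℝ) ≤ 1 := by exact_mod_cast hG.digit_le_one e k
  rw [inv_pow, div_eq_mul_inv]
  exact mul_le_of_le_one_left (by have := goldenRatio_pos; positivity) this

lemma digit_div_nonneg (e : ℕ → ℕ) (k : ℕ) : 0 ≤ (e k : ℝ) / φ ^ (k + 1) := by
  have := goldenRatio_pos
  positivity

lemma summable_monna (hG : IsFibSystem G) (e : KG G) :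
    Summable fun k => (e.val k : ℝ) / φ ^ (k + 1) :=
  Summable.of_nonneg_of_le (digit_div_nonneg _) (digit_div_le hG e) summable_goldenRatio_inv_pow

lemma monna_nonneg (e : ℕ → ℕ) : 0 ≤ monna φ e := tsum_nonneg (digit_div_nonneg e)

lemma monna_le (hG : IsFibSystem G) {e : KG G} {M : ℕ} (h : partialValue G e.val M = 0) :
    monna φ e.val * φ ^ M ≤ φ := by
  have hφ := goldenRatio_pos
  have hz : ∑ k ∈ Finset.range M, (e.val k : ℝ) / φ ^ (k + 1) = 0 :=
    Finset.sum_eq_zero fun k hk => by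
      rw [partialValue_eq_zero hG.pos h (Finset.mem_range.1 hk)]; simp
  have hgeo : HasSum (fun k : ℕ => (φ⁻¹) ^ k) (1 - φ⁻¹)⁻¹ :=
    hasSum_geometric_of_lt_one (inv_nonneg.2 hφ.le) (inv_lt_one_of_one_lt₀ one_lt_goldenRatio)
  have hgeo' : HasSum (fun k : ℕ => (φ⁻¹) ^ (k + M + 1)) ((φ⁻¹) ^ (M + 1) * (1 - φ⁻¹)⁻¹) := by
    refine (hgeo.mul_left ((φ⁻¹) ^ (M + 1))).congr_fun fun k => ?_
    rw [← pow_add]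
    congr 1
    omega
  have hle : monna φ e.val ≤ (φ⁻¹) ^ (M + 1) * (1 - φ⁻¹)⁻¹ := by
    rw [monna, ← (summable_monna hG e).sum_add_tsum_nat_add M, hz, zero_add, ← hgeo'.tsum_eq]
    exact ((summable_nat_add_iff M).2 (summable_monna hG e)).tsum_le_tsum
      (fun k => digit_div_le hG e (k + M)) hgeo'.summable
  have hval : (φ⁻¹) ^ (M + 1) * (1 - φ⁻¹)⁻¹ * φ ^ M = φ := by
    have h2 : (1 - φ⁻¹)⁻¹ = φ ^ 2 := by
      have hsq := goldenRatio_sq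
      rw [inv_eq_iff_eq_inv]
      generalize φ = t at hφ hsq ⊢
      field_simp
      linear_combination hsq
    rw [h2, inv_pow]
    generalize φ = t at hφ ⊢
    field_simp
    ring
  calc monna φ e.val * φ ^ M ≤ _ := by gcongr
    _ = φ := hval

lemma monna_raise (hG : IsFibSystem G) {e e' : KG G} {k : ℕ}
    (h : ∀ i, e'.val i = e.val i + if i = k then 1 else 0) :
    monna φ e'.val = monna φ e.val + (φ ^ (k + 1))⁻¹ := by
  have h₁ : HasSum (fun i => if i = k then (φ ^ (k + 1))⁻¹ else 0) (φ ^ (k + 1))⁻¹ :=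
    hasSum_ite_eq k _
  refine (((summable_monna hG e).hasSum.add h₁).congr_fun fun i => ?_).tsum_eq
  rw [h]
  split_ifs with hi <;> simp [hi, add_div]

/-- Along a full block of the odometer the points below `x` are counted by `fibCount`. -/
lemma IsOdometer.sum_block (hτ : IsOdometer G τ) (hG : IsFibSystem G) (x : ℝ) (M : ℕ) {e : KG G}
    (h₀ : partialValue G e.val M = 0) (h₁ : e.val M = 0) :
    ∑ n ∈ Finset.range (G M), (Set.Iio x).indicator (fun _ => (1 : ℝ)) (monna φ (τ^[n] e).val)
      = fibCount (M + 2) (x - monna φ e.val) := by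
  have base : ∀ y : ℝ, (Set.Iio x).indicator (fun _ => (1 : ℝ)) y = fibCount 1 (x - y) := by
    intro y
    simp [fibCount, Set.indicator_apply]
  induction M using Nat.twoStepInduction generalizing e with
  | zero =>
    rw [hG.zero, Finset.sum_range_one, base, fibCount_add_two]
    simp [fibCount]
  | one =>
    have hr := hτ.iterate_raise hG (k := 0) h₀ h₁
    rw [hG.zero, Function.iterate_one] at hr
    rw [hG.one, Finset.sum_range_succ, Finset.sum_range_one, base, base, Function.iterate_zero,
      Function.iterate_one, id, monna_raise hG hr, fibCount_add_two, fibCount_add_two]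
    simp [fibCount, sub_sub]
  | more M ih₀ ih₁ =>
    have hz := fun i hi => partialValue_eq_zero hG.pos (k := i) h₀ hi
    have hr := hτ.iterate_raise hG (k := M + 1) h₀ h₁
    have hp : ∀ m, m ≤ M + 2 → partialValue G e.val m = 0 := fun m hm =>
      Nat.le_zero.1 (h₀ ▸ partialValue_mono G e.val hm)
    have hp' : partialValue G (τ^[G (M + 1)] e).val M = 0 := by
      rw [← hp M (by omega)]
      exact partialValue_congr fun k hk => by rw [hr, if_neg (by omega), add_zero]
    rw [hG.add_two, Finset.sum_range_add, ih₁ (hp _ (by omega)) (hz _ (by omega))]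
    simp only [add_comm (G (M + 1)), Function.iterate_add_apply]
    rw [ih₀ hp' (by rw [hr, if_neg (by omega), hz M (by omega)]), monna_raise hG hr,
      fibCount_add_two (M + 2), sub_sub]

lemma indicator_Ico_eq_sub {a b : ℝ} (hab : a ≤ b) (y : ℝ) :
    (Set.Ico a b).indicator (fun _ => (1 : ℝ)) y
      = (Set.Iio b).indicator (fun _ => (1 : ℝ)) y - (Set.Iio a).indicator (fun _ => (1 : ℝ)) y := by
  simp only [Set.indicator_apply, Set.mem_Ico, Set.mem_Iio]
  split_ifs <;> grind

lemma abs_sum_indicator_sub_le {a b : ℝ} (h0a : 0 ≤ a) (hab : a ≤ b) (hb1 : b ≤ 1) (x : ℕ → ℝ)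
    (N : ℕ) :
    |∑ n ∈ Finset.range N, (Set.Ico a b).indicator (fun _ => (1 : ℝ)) (x n) - N * (b - a)| ≤ N := by
  have hN : (0 : ℝ) ≤ N := Nat.cast_nonneg _
  have h₀ : 0 ≤ ∑ n ∈ Finset.range N, (Set.Ico a b).indicator (fun _ => (1 : ℝ)) (x n) :=
    Finset.sum_nonneg fun n _ => Set.indicator_nonneg (fun _ _ => zero_le_one) _
  have h₁ : ∑ n ∈ Finset.range N, (Set.Ico a b).indicator (fun _ => (1 : ℝ)) (x n) ≤ N := by
    simpa using Finset.sum_le_card_nsmul (Finset.range N) _ 1 fun n _ =>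
      Set.indicator_le_self' (s := Set.Ico a b) (f := fun _ => (1 : ℝ))
        (fun _ _ => zero_le_one) (x n)
  rw [abs_le]
  constructor <;> nlinarith

lemma IsOdometer.abs_sum_block_sub_le (hτ : IsOdometer G τ) (hG : IsFibSystem G) {a b : ℝ}
    (h0a : 0 ≤ a) (hab : a ≤ b) (hb1 : b ≤ 1) {M : ℕ} {e : KG G}
    (h₀ : partialValue G e.val M = 0) (h₁ : e.val M = 0) :
    |∑ n ∈ Finset.range (G M),
        (Set.Ico a b).indicator (fun _ => (1 : ℝ)) (monna φ (τ^[n] e).val)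
      - G M * (b - a)| ≤ 2 * (M + 5) := by
  have hGM : (G M : ℝ) = Nat.fib (M + 2) := by rw [hG.eq_fib]
  simp only [indicator_Ico_eq_sub hab, Finset.sum_sub_distrib]
  rw [hτ.sum_block hG b M h₀ h₁, hτ.sum_block hG a M h₀ h₁, hGM]
  have hs := monna_nonneg e.val
  have hB := abs_fibCount_shift_sub_le (M + 2) (h0a.trans hab) hb1 hs
  have hA := abs_fibCount_shift_sub_le (M + 2) h0a (hab.trans hb1) hs
  have hsF : monna φ e.val * Nat.fib (M + 2) ≤ 3 := by
    have h2 := goldenRatio_lt_two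
    have hsq := goldenRatio_sq
    have hφ := goldenRatio_pos
    calc monna φ e.val * Nat.fib (M + 2) ≤ monna φ e.val * φ ^ (M + 1) := by
          gcongr
          exact fib_le_goldenRatio_pow (M + 1)
      _ = monna φ e.val * φ ^ M * φ := by ring
      _ ≤ φ * φ := by gcongr; exact monna_le hG h₀
      _ ≤ 3 := by nlinarith
  rw [abs_le] at hA hB ⊢
  push_cast at hA hB
  constructor <;> nlinarith [hA.1, hA.2, hB.1, hB.2]

lemma IsOdometer.exists_block (hτ : IsOdometer G τ) (hG : IsFibSystem G) {a b : ℝ}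
    (h0a : 0 ≤ a) (hab : a ≤ b) (hb1 : b ≤ 1) {M : ℕ} {e : KG G}
    (h : partialValue G e.val (M + 1) = 0) :
    ∃ L, G M ≤ L ∧ L ≤ G (M + 1) ∧ partialValue G (τ^[L] e).val (M + 1) = 0 ∧
      |∑ n ∈ Finset.range L, (Set.Ico a b).indicator (fun _ => (1 : ℝ)) (monna φ (τ^[n] e).val)
        - L * (b - a)| ≤ 2 * (M + 6) := by
  have hm : G M < G (M + 1) := hG.strictMono M.lt_succ_self
  have hpos := hG.pos M
  rcases hG.digit_eq_zero_or_one e (M + 1) with hd | hd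
  · refine ⟨G (M + 1), hm.le, le_rfl, ?_, ?_⟩
    · obtain ⟨L, hL⟩ : ∃ L, G (M + 1) = L + 1 := ⟨G (M + 1) - 1, by omega⟩
      have hv := hτ.iterate hG h hd (n := L) (by omega)
      rw [hL, Function.iterate_succ_apply']
      exact hτ.carry hG _ ⟨M + 1, le_rfl, by omega⟩
    · have := hτ.abs_sum_block_sub_le hG h0a hab hb1 h hd
      push_cast at this
      linarith
  · have h' : partialValue G e.val M = 0 :=
      Nat.le_zero.1 (h ▸ partialValue_mono G e.val M.le_succ)
    have hd' : e.val M = 0 := partialValue_eq_zero hG.pos h M.lt_succ_self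
    refine ⟨G M, le_rfl, hm.le, ?_, ?_⟩
    · obtain ⟨L, hL⟩ : ∃ L, G M = L + 1 := ⟨G M - 1, by omega⟩
      have hv := hτ.iterate hG h' hd' (n := L) (by omega)
      have hr := hG.add_two M
      rw [hL, Function.iterate_succ_apply']
      refine hτ.carry hG _ ⟨M + 2, by omega, ?_⟩
      rw [partialValue_succ, partialValue_succ, hv.1, hv.2 M le_rfl, hv.2 (M + 1) M.le_succ, hd, hd']
      omega
    · have := hτ.abs_sum_block_sub_le hG h0a hab hb1 h' hd'
      linarith

lemma IsOdometer.abs_sum_sub_le_of_partialValue_eq_zero (hτ : IsOdometer G τ) (hG : IsFibSystem G)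
    {a b : ℝ} (h0a : 0 ≤ a) (hab : a ≤ b) (hb1 : b ≤ 1) (M N : ℕ) {e : KG G}
    (h : partialValue G e.val (M + 1) = 0) :
    |∑ n ∈ Finset.range N, (Set.Ico a b).indicator (fun _ => (1 : ℝ)) (monna φ (τ^[n] e).val)
      - N * (b - a)| ≤ N * (2 * (M + 6) / G M) + G (M + 1) := by
  have hpos := hG.pos M
  have hposR : (0 : ℝ) < G M := by exact_mod_cast hpos
  induction N using Nat.strong_induction_on generalizing e with
  | _ N ih =>
    obtain ⟨L, hL₀, hL₁, hL₂, hL₃⟩ := hτ.exists_block hG h0a hab hb1 h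
    rcases lt_or_ge N L with hN | hN
    · have h₁ : (N : ℝ) ≤ G (M + 1) := by exact_mod_cast hN.le.trans hL₁
      have h₂ : (0 : ℝ) ≤ N * (2 * (M + 6) / G M) := by positivity
      linarith [abs_sum_indicator_sub_le h0a hab hb1 (fun n => monna φ (τ^[n] e).val) N]
    · obtain ⟨N', rfl⟩ := Nat.exists_eq_add_of_le hN
      have hrest := ih N' (by omega) hL₂
      have hblock : (2 * (M + 6) : ℝ) ≤ L * (2 * (M + 6) / G M) := by
        have : (G M : ℝ) ≤ L := by exact_mod_cast hL₀
        calc (2 * (M + 6) : ℝ) = G M * (2 * (M + 6) / G M) := by field_simp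
          _ ≤ _ := by gcongr
      rw [Finset.sum_range_add]
      simp only [add_comm L, Function.iterate_add_apply]
      rw [abs_le] at hrest hL₃ ⊢
      push_cast
      constructor <;> linarith [hrest.1, hrest.2, hL₃.1, hL₃.2]

lemma IsOdometer.exists_abs_sum_sub_le (hτ : IsOdometer G τ) (hG : IsFibSystem G)
    {a b : ℝ} (h0a : 0 ≤ a) (hab : a ≤ b) (hb1 : b ≤ 1) (M : ℕ) (e : KG G) :
    ∃ C : ℝ, ∀ N : ℕ,
      |∑ n ∈ Finset.range N, (Set.Ico a b).indicator (fun _ => (1 : ℝ)) (monna φ (τ^[n] e).val)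
        - N * (b - a)| ≤ N * (2 * (M + 6) / G M) + C := by
  have hpos : (0 : ℝ) < G M := by exact_mod_cast hG.pos M
  have hcons : ∀ e : KG G, (∃ C : ℝ, ∀ N : ℕ,
      |∑ n ∈ Finset.range N, (Set.Ico a b).indicator (fun _ => (1 : ℝ)) (monna φ (τ^[n] (τ e)).val)
        - N * (b - a)| ≤ N * (2 * (M + 6) / G M) + C) → ∃ C : ℝ, ∀ N : ℕ,
      |∑ n ∈ Finset.range N, (Set.Ico a b).indicator (fun _ => (1 : ℝ)) (monna φ (τ^[n] e).val)
        - N * (b - a)| ≤ N * (2 * (M + 6) / G M) + C := by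
    rintro e ⟨C, hC⟩
    have hC₀ : 0 ≤ C := by simpa using hC 0
    refine ⟨C + 1, fun N => ?_⟩
    cases N with
    | zero => simpa using hC₀.trans (by linarith)
    | succ N =>
      have h₁ := hC N
      have h₂ := abs_sum_indicator_sub_le h0a hab hb1 (fun _ => monna φ e.val) 1
      have h₃ : (0 : ℝ) ≤ 2 * (M + 6) / G M := by positivity
      simp only [Finset.sum_range_one, Nat.cast_one, one_mul] at h₂
      rw [Finset.sum_range_succ']
      simp only [Function.iterate_succ_apply, Function.iterate_zero, id]
      rw [abs_le] at h₁ h₂ ⊢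
      push_cast
      constructor <;> linarith [h₁.1, h₁.2, h₂.1, h₂.2]
  obtain ⟨d, hd⟩ : ∃ d, d = G (M + 1) - partialValue G e.val (M + 1) := ⟨_, rfl⟩
  induction d generalizing e with
  | zero => have := hG.partialValue_lt e (M + 1); omega
  | succ d ih =>
    apply hcons
    by_cases h : partialValue G e.val (M + 1) + 1 < G (M + 1) ∧
        partialValue G e.val (M + 2) + 1 < G (M + 2)
    · exact ih (τ e) (by rw [(hτ.step hG e h.1 h.2).1]; omega)
    · refine ⟨G (M + 1), fun N => hτ.abs_sum_sub_le_of_partialValue_eq_zero hG h0a hab hb1 M N ?_⟩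
      apply hτ.carry hG
      rcases not_and_or.1 h with h | h
      · exact ⟨_, le_rfl, h⟩
      · exact ⟨M + 2, by omega, h⟩

lemma IsFibSystem.exists_div_lt (hG : IsFibSystem G) {ε : ℝ} (hε : 0 < ε) :
    ∃ M : ℕ, (2 * (M + 6) : ℝ) / G M < ε := by
  obtain ⟨n, hn⟩ := exists_nat_gt (max 5 (8 / ε))
  have hn5 : (5 : ℝ) < n := (le_max_left _ _).trans_lt hn
  have hn5' : 5 ≤ n := by exact_mod_cast hn5.le
  have hnε : 8 < n * ε := (div_lt_iff₀ hε).1 ((le_max_right _ _).trans_lt hn)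
  refine ⟨2 * n, ?_⟩
  have hfib : n ^ 2 ≤ G (2 * n) := by
    have h₁ := Nat.le_fib_self hn5'
    have h₂ : Nat.fib (2 * n + 1) ≤ Nat.fib (2 * n + 2) := Nat.fib_le_fib_succ
    rw [hG.eq_fib]
    rw [Nat.fib_two_mul_add_one] at h₂
    nlinarith [Nat.pow_le_pow_left h₁ 2]
  have hfibR : (n : ℝ) ^ 2 ≤ G (2 * n) := by exact_mod_cast hfib
  rw [div_lt_iff₀ (by nlinarith)]
  push_cast
  nlinarith

end Orbit

/-- Kakutani–Fibonacci transformation: for the Fibonacci numeration system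
`G₀ = 1, G₁ = 2, G_{n+2} = G_{n+1} + G_n` with `β = (1+√5)/2` the golden ratio
and odometer `τ`, for every `e ∈ K_G` the orbit sequence `(φ_β(τⁿ e))_{n ≥ 0}`
is uniformly distributed in `[0,1)`; i.e. the Kakutani–Fibonacci transformation
is uniquely ergodic. -/
theorem kakutani_fibonacci_uniquely_ergodic (G : ℕ → ℕ)
    (hG : G 0 = 1 ∧ G 1 = 2 ∧ ∀ n, G (n + 2) = G (n + 1) + G n)
    (β : ℝ) (hβ : β = (1 + Real.sqrt 5) / 2)
    (τ : KG G → KG G) (hτ : IsOdometer G τ) :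
    ∀ e : KG G, IsUDZero (fun n => monna β ((τ^[n]) e).val) := by
  intro e a b h0a hab hb1
  obtain rfl : β = Real.goldenRatio := hβ
  have hG' : IsFibSystem G := ⟨hG.1, hG.2.1, hG.2.2⟩
  rw [Metric.tendsto_atTop]
  intro ε hε
  obtain ⟨M, hM⟩ := hG'.exists_div_lt (half_pos hε)
  obtain ⟨C, hC⟩ := hτ.exists_abs_sum_sub_le hG' h0a hab hb1 M e
  obtain ⟨N₀, hN₀⟩ := exists_nat_gt (max 0 (C / (ε / 2)))
  refine ⟨N₀, fun N hN => ?_⟩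
  have hlt : max 0 (C / (ε / 2)) < N := hN₀.trans_le (by exact_mod_cast hN)
  have hpos : (0 : ℝ) < N := (le_max_left _ _).trans_lt hlt
  have hCN : C < N * (ε / 2) := (div_lt_iff₀ (half_pos hε)).1 ((le_max_right _ _).trans_lt hlt)
  rw [Real.dist_eq, div_sub' hpos.ne', abs_div, abs_of_pos hpos, div_lt_iff₀ hpos]
  refine (hC N).trans_lt ?_
  nlinarith [mul_lt_mul_of_pos_left hM hpos]
end

section
/- Let a ≥ 1 and d ≥ 1 be integers, let G be the numeration system with all coefficients equal to a and order d, and let β be its characteristic root. Then the β-adic van der Corput sequence (φ_β(n))_{n≥1} is uniformly distributed in [0,1). -/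
open MeasureTheory Filter

/-- The numeration system with all coefficients equal to `b` and order `d`:
`G 0 = 1`, `G k = b*(G (k-1) + ⋯ + G 0) + 1` for `1 ≤ k < d`, and
`G (n+d) = b*(G (n+d-1) + ⋯ + G n)` for all `n`. -/
def IsNumSys (b d : ℕ) (G : ℕ → ℕ) : Prop :=
  G 0 = 1 ∧
  (∀ k, 1 ≤ k → k < d → G k = b * (∑ j ∈ Finset.range k, G j) + 1) ∧
  (∀ n, G (n + d) = b * ∑ j ∈ Finset.range d, G (n + j))

/-- `β` is the characteristic root: the real root greater than 1 of
`x^d = b*(x^(d-1) + ⋯ + x + 1)`. -/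
def IsCharRoot (b d : ℕ) (β : ℝ) : Prop :=
  1 < β ∧ β ^ d = (b : ℝ) * ∑ j ∈ Finset.range d, β ^ j

namespace IsNumSys

variable {a d : ℕ} {G : ℕ → ℕ}

lemma mul_sum_le (hG : IsNumSys a d G) (m t : ℕ) (ht : t < d) :
    a * ∑ i ∈ Finset.range (t + 1), G (m + i) ≤ G (m + t + 1) := by
  obtain ⟨-, h1, h2⟩ := hG
  rcases lt_or_ge (m + t + 1) d with h | h
  · rw [h1 (m + t + 1) (by omega) h, show m + t + 1 = m + (t + 1) by omega,
      Finset.sum_range_add _ m (t + 1), mul_add]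
    omega
  · obtain ⟨s, hs⟩ := Nat.exists_eq_add_of_le' h
    rw [hs, h2 s]
    obtain ⟨r, rfl⟩ : ∃ r, m = s + r := ⟨m - s, by omega⟩
    obtain rfl : d = r + (t + 1) := by omega
    rw [Finset.sum_range_add _ r, mul_add]
    simp only [add_assoc]
    omega

lemma le_succ (hG : IsNumSys a d G) (ha : 1 ≤ a) (hd : 1 ≤ d) (n : ℕ) : G n ≤ G (n + 1) := by
  have h := hG.mul_sum_le n 0 hd
  simp only [zero_add, Finset.sum_range_one, add_zero] at h
  nlinarith

lemma monotone (hG : IsNumSys a d G) (ha : 1 ≤ a) (hd : 1 ≤ d) : Monotone G :=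
  monotone_nat_of_le_succ (hG.le_succ ha hd)

lemma pos (hG : IsNumSys a d G) (ha : 1 ≤ a) (hd : 1 ≤ d) (n : ℕ) : 0 < G n := by
  have := hG.monotone ha hd (Nat.zero_le n)
  rw [hG.1] at this
  omega

lemma succ_le (hG : IsNumSys a d G) (hd : 1 ≤ d) (n : ℕ) : G (n + 1) ≤ (a + 1) * G n := by
  rcases lt_or_ge (n + 1) d with h | h
  · rw [hG.2.1 (n + 1) (by omega) h, Finset.sum_range_succ]
    rcases Nat.eq_zero_or_pos n with rfl | hn
    · simp [hG.1]
    · have := hG.2.1 n hn (by omega)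
      nlinarith
  · obtain ⟨s, hs⟩ := Nat.exists_eq_add_of_le' h
    obtain ⟨t, rfl⟩ : ∃ t, d = t + 1 := ⟨d - 1, by omega⟩
    obtain rfl : n = s + t := by omega
    have h3 := hG.2.2 s
    rw [Finset.sum_range_succ] at h3
    rw [hs, h3]
    have : a * ∑ i ∈ Finset.range t, G (s + i) ≤ G (s + t) := by
      rcases Nat.eq_zero_or_pos t with rfl | ht
      · simp
      · obtain ⟨r, rfl⟩ : ∃ r, t = r + 1 := ⟨t - 1, by omega⟩
        exact hG.mul_sum_le s r (by omega)
    nlinarith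

lemma succ_add_mul (hG : IsNumSys a d G) (n : ℕ) :
    G (n + d + 1) + a * G n = (a + 1) * G (n + d) := by
  have h1 := hG.2.2 (n + 1)
  have h2 := hG.2.2 n
  have h3 := Finset.sum_range_succ (fun j => G (n + j)) d
  rw [Finset.sum_range_succ'] at h3
  have h4 : ∑ j ∈ Finset.range d, G (n + (j + 1)) = ∑ j ∈ Finset.range d, G (n + 1 + j) :=
    Finset.sum_congr rfl fun j _ => by congr 1; omega
  rw [h4] at h3
  simp only [add_zero] at h3
  rw [show n + d + 1 = n + 1 + d by omega]
  nlinarith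

end IsNumSys

/-- The digit sequence `e` satisfies the greedy condition for `G`. -/
def IsGreedy (G e : ℕ → ℕ) : Prop :=
  ∀ K, ∑ k ∈ Finset.range K, e k * G k < G K

/-- All digits are at most `a`, and no `d` consecutive digits are all equal to `a`. -/
def IsAdmissible (a d : ℕ) (e : ℕ → ℕ) : Prop :=
  (∀ k, e k ≤ a) ∧ ∀ m, ∃ i < d, e (m + i) ≠ a

section Digits

variable {a d : ℕ} {G : ℕ → ℕ}

lemma IsGreedy.isAdmissible (hG : IsNumSys a d G) (hd : 1 ≤ d) {e : ℕ → ℕ}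
    (he : IsGreedy G e) : IsAdmissible a d e := by
  have hle : ∀ k, e k ≤ a := by
    intro k
    by_contra! h
    have h1 := he (k + 1)
    have h2 := hG.succ_le hd k
    rw [Finset.sum_range_succ] at h1
    have : (a + 1) * G k ≤ e k * G k := Nat.mul_le_mul_right _ h
    omega
  refine ⟨hle, fun m => ?_⟩
  by_contra! h
  have h1 := he (m + d)
  rw [Finset.sum_range_add, hG.2.2 m, Finset.mul_sum] at h1
  have : ∑ i ∈ Finset.range d, e (m + i) * G (m + i) = ∑ i ∈ Finset.range d, a * G (m + i) :=
    Finset.sum_congr rfl fun i hi => by rw [h i (Finset.mem_range.1 hi)]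
  omega

lemma sum_lt_of_digits (hG : IsNumSys a d G) {e : ℕ → ℕ} (K : ℕ)
    (hle : ∀ k < K, e k ≤ a) (hrun : ∀ m, m + d ≤ K → ∃ i < d, e (m + i) ≠ a) :
    ∑ k ∈ Finset.range K, e k * G k < G K := by
  induction K using Nat.strong_induction_on with
  | _ K ih =>
    by_cases h : ∃ m, m < K ∧ K ≤ m + d ∧ e m ≠ a
    · obtain ⟨m, hmK, hKm, hm⟩ := h
      obtain ⟨t, rfl⟩ : ∃ t, K = m + (t + 1) := ⟨K - m - 1, by omega⟩
      have h1 := ih m hmK (fun k hk => hle k (by omega)) (fun k hk => hrun k (by omega))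
      have h2 := hG.mul_sum_le m t (by omega)
      rw [Finset.sum_range_add]
      rw [Finset.sum_range_succ'] at h2 ⊢
      have h3 : ∑ i ∈ Finset.range t, e (m + (i + 1)) * G (m + (i + 1)) ≤
          a * ∑ i ∈ Finset.range t, G (m + (i + 1)) := by
        rw [Finset.mul_sum]
        exact Finset.sum_le_sum fun i hi => Nat.mul_le_mul_right _
          (hle _ (by have := Finset.mem_range.1 hi; omega))
      have h4 : (e m + 1) * G m ≤ a * G m :=
        Nat.mul_le_mul_right _ (lt_of_le_of_ne (hle m hmK) hm)
      simp only [add_zero, ← add_assoc] at *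
      nlinarith
    · push Not at h
      rcases lt_or_ge K d with hK | hK
      · rcases Nat.eq_zero_or_pos K with rfl | hK0
        · simp [hG.1]
        · rw [hG.2.1 K hK0 hK, Finset.mul_sum]
          refine Nat.lt_succ_of_le (Finset.sum_le_sum fun i hi => ?_)
          exact Nat.mul_le_mul_right _ (hle i (Finset.mem_range.1 hi))
      · obtain ⟨i, hi, hne⟩ := hrun (K - d) (by omega)
        exact absurd (h (K - d + i) (by omega) (by omega)) hne

lemma digits_eq_of_sum_eq {e e' : ℕ → ℕ} (K : ℕ)
    (he : ∀ k < K, ∑ i ∈ Finset.range k, e i * G i < G k)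
    (he' : ∀ k < K, ∑ i ∈ Finset.range k, e' i * G i < G k)
    (h : ∑ i ∈ Finset.range K, e i * G i = ∑ i ∈ Finset.range K, e' i * G i) :
    ∀ k < K, e k = e' k := by
  induction K with
  | zero => simp
  | succ K ih =>
    have h1 := he K (by omega)
    have h2 := he' K (by omega)
    rw [Finset.sum_range_succ, Finset.sum_range_succ] at h
    have hK : e K = e' K := by
      have h3 := congrArg (· / G K) h
      have hp : 0 < G K := by omega
      simpa [Nat.add_mul_div_right _ _ hp, Nat.div_eq_of_lt h1, Nat.div_eq_of_lt h2] using h3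
    rw [hK] at h
    have h4 := ih (fun k hk => he k (by omega)) (fun k hk => he' k (by omega)) (by omega)
    intro k hk
    rcases Nat.lt_succ_iff_lt_or_eq.1 hk with hk | rfl
    · exact h4 k hk
    · exact hK

lemma IsGExpansion.isGreedy {n : ℕ} {e : ℕ → ℕ} (hG0 : G 0 = 1) (h : IsGExpansion G n e) :
    IsGreedy G e := by
  intro K
  rcases Nat.eq_zero_or_pos K with rfl | hK
  · simp [hG0]
  · exact h.2 K hK

lemma IsGExpansion.exists_forall_sum_eq {n : ℕ} {e : ℕ → ℕ} (h : IsGExpansion G n e) :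
    ∃ K₀, ∀ K ≥ K₀, ∑ k ∈ Finset.range K, e k * G k = n := by
  obtain ⟨⟨K₀, h0, hs⟩, -⟩ := h
  refine ⟨K₀, fun K hK => ?_⟩
  rw [← hs]
  refine (Finset.sum_subset (Finset.range_subset_range.2 hK) fun k _ hk => ?_).symm
  rw [h0 k (by simpa using hk), zero_mul]

lemma IsGExpansion.unique {n : ℕ} {e e' : ℕ → ℕ} (hG0 : G 0 = 1) (h : IsGExpansion G n e)
    (h' : IsGExpansion G n e') : e = e' := by
  obtain ⟨K, hK⟩ := h.exists_forall_sum_eq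
  obtain ⟨K', hK'⟩ := h'.exists_forall_sum_eq
  funext k
  refine digits_eq_of_sum_eq (max (max K K') (k + 1)) (fun j _ => h.isGreedy hG0 j)
    (fun j _ => h'.isGreedy hG0 j) ?_ k (by omega)
  rw [hK _ (by omega), hK' _ (by omega)]

lemma IsGExpansion.sum_eq_of_lt (hmono : Monotone G) {n j : ℕ} {e : ℕ → ℕ}
    (h : IsGExpansion G n e) (hn : n < G j) : ∑ k ∈ Finset.range j, e k * G k = n := by
  obtain ⟨K, hK⟩ := h.exists_forall_sum_eq
  rw [← hK (max K j) (le_max_left _ _)]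
  refine Finset.sum_subset (Finset.range_subset_range.2 (le_max_right _ _)) fun k hk hkj => ?_
  simp only [Finset.mem_range] at hk hkj
  have h1 : e k * G k ≤ n := by
    rw [← hK (max K j) (le_max_left _ _)]
    exact Finset.single_le_sum (f := fun k => e k * G k) (fun _ _ => Nat.zero_le _)
      (Finset.mem_range.2 hk)
  have h2 : G j ≤ G k := hmono (by omega)
  have h3 : e k = 0 := by
    by_contra h0
    have : 1 * G k ≤ e k * G k := Nat.mul_le_mul_right _ (Nat.pos_of_ne_zero h0)
    omega
  rw [h3, zero_mul]

/-- The value of the word formed by the `K` lowest digits of `e`, read in reverse order. -/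
def revSum (G : ℕ → ℕ) (K : ℕ) (e : ℕ → ℕ) : ℕ :=
  ∑ i ∈ Finset.range K, e i * G (K - 1 - i)

lemma revSum_eq (K : ℕ) (e : ℕ → ℕ) :
    revSum G K e = ∑ i ∈ Finset.range K, e (K - 1 - i) * G i := by
  rw [revSum, ← Finset.sum_range_reflect]
  refine Finset.sum_congr rfl fun i hi => ?_
  congr 2
  have := Finset.mem_range.1 hi
  omega

lemma IsAdmissible.sum_reverse_lt (hG : IsNumSys a d G) {e : ℕ → ℕ}
    (he : IsAdmissible a d e) {k K : ℕ} (hk : k ≤ K) :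
    ∑ i ∈ Finset.range k, e (K - 1 - i) * G i < G k := by
  refine sum_lt_of_digits hG k (fun i _ => he.1 _) fun m hm => ?_
  obtain ⟨i, hi, h⟩ := he.2 (K - m - d)
  exact ⟨d - 1 - i, by omega, by rwa [show K - 1 - (m + (d - 1 - i)) = K - m - d + i by omega]⟩

lemma digits_eq_of_revSum_eq (hG : IsNumSys a d G) {e e' : ℕ → ℕ}
    (he : IsAdmissible a d e) (he' : IsAdmissible a d e') {K : ℕ}
    (h : revSum G K e = revSum G K e') : ∀ k < K, e k = e' k := by
  rw [revSum_eq, revSum_eq] at h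
  intro k hk
  have := digits_eq_of_sum_eq (e := fun i => e (K - 1 - i)) (e' := fun i => e' (K - 1 - i)) K
    (fun k hk => he.sum_reverse_lt hG hk.le) (fun k hk => he'.sum_reverse_lt hG hk.le)
    h (K - 1 - k) (by omega)
  simpa [show K - 1 - (K - 1 - k) = k by omega] using this

lemma exists_block_expansion (hG0 : G 0 = 1) (hmono : Monotone G) {N n j i : ℕ} {e f : ℕ → ℕ}
    (he : IsGExpansion G N e) (hf : IsGExpansion G n f) (hn : n < G j) (hi : i < e j) :
    ∃ g, (∀ k < j, g k = f k) ∧ ∀ H, H + ∑ k ∈ Finset.range (j + 1), e k * G k = N →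
      IsGExpansion G (H + i * G j + n) g := by
  set g : ℕ → ℕ := fun k => if k < j then f k else if k = j then i else e k with hg
  have hlow : ∀ K ≤ j, ∑ k ∈ Finset.range K, g k * G k = ∑ k ∈ Finset.range K, f k * G k :=
    fun K hK => Finset.sum_congr rfl fun k hk => by
      have := Finset.mem_range.1 hk
      simp [hg, show k < j by omega]
  have hmid : ∑ k ∈ Finset.range (j + 1), g k * G k = n + i * G j := by
    rw [Finset.sum_range_succ, hlow j le_rfl, hf.sum_eq_of_lt hmono hn]
    simp [hg]
  have hhigh : ∀ K ≥ j + 1, ∑ k ∈ Finset.range K, g k * G k +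
      ∑ k ∈ Finset.range (j + 1), e k * G k = ∑ k ∈ Finset.range K, e k * G k + (n + i * G j) := by
    intro K hK
    induction K, hK using Nat.le_induction with
    | base => rw [hmid, add_comm]
    | succ K hK ih =>
      rw [Finset.sum_range_succ, Finset.sum_range_succ _ K]
      have : g K = e K := by simp [hg, show ¬ K < j by omega, show K ≠ j by omega]
      rw [this]
      omega
  have hlt : n + i * G j < ∑ k ∈ Finset.range (j + 1), e k * G k := by
    rw [Finset.sum_range_succ]
    have : (i + 1) * G j ≤ e j * G j := Nat.mul_le_mul_right _ hi
    linarith [Nat.zero_le (∑ k ∈ Finset.range j, e k * G k)]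
  refine ⟨g, fun k hk => by simp [hg, hk], fun H hH => ⟨?_, fun K _ => ?_⟩⟩
  · obtain ⟨⟨K, hK, hsum⟩, -⟩ := id he
    obtain ⟨K', hK'⟩ := he.exists_forall_sum_eq
    refine ⟨max (max K K') (j + 1), fun k hk => ?_, ?_⟩
    · simp [hg, show ¬ k < j by omega, show k ≠ j by omega, hK k (by omega)]
    · have h1 := hhigh (max (max K K') (j + 1)) (by omega)
      rw [hK' (max (max K K') (j + 1)) (by omega)] at h1
      omega
  · rcases le_or_gt K j with hK | hK
    · rw [hlow K hK]
      exact hf.isGreedy hG0 K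
    · have h1 := hhigh K hK
      have h2 := he.isGreedy hG0 K
      omega

end Digits

section Analysis

variable {a d : ℕ} {G : ℕ → ℕ} {β : ℝ}

lemma IsCharRoot.sub_one_mul_pow (hβ : IsCharRoot a d β) : (β - 1) * β ^ d = a * (β ^ d - 1) := by
  rw [← mul_geom_sum β d]
  nth_rewrite 1 [hβ.2]
  ring

lemma abs_add_sub_pow_mul_le (hβ : 0 ≤ β) {C : ℝ} (m k : ℕ)
    (h : ∀ t < k, |(G (m + t + 1) : ℝ) - β * G (m + t)| ≤ C) :
    |(G (m + k) : ℝ) - β ^ k * G m| ≤ C * ∑ t ∈ Finset.range k, β ^ t := by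
  induction k with
  | zero => simp
  | succ k ih =>
    have h1 := ih fun t ht => h t (by omega)
    have h2 := h k (by omega)
    rw [geom_sum_succ]
    calc |(G (m + (k + 1)) : ℝ) - β ^ (k + 1) * G m|
        = |((G (m + k + 1) : ℝ) - β * G (m + k)) + β * (G (m + k) - β ^ k * G m)| := by
          congr 1; rw [← add_assoc]; ring
      _ ≤ |(G (m + k + 1) : ℝ) - β * G (m + k)| + β * |G (m + k) - β ^ k * G m| := by
          refine (abs_add_le _ _).trans ?_
          rw [abs_mul, abs_of_nonneg hβ]
      _ ≤ C + β * (C * ∑ t ∈ Finset.range k, β ^ t) := by gcongr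
      _ = C * (β * ∑ t ∈ Finset.range k, β ^ t + 1) := by ring

lemma IsNumSys.exists_abs_succ_sub_le (hG : IsNumSys a d G) (hβ : IsCharRoot a d β) :
    ∃ C, 0 ≤ C ∧ ∀ n, |(G (n + 1) : ℝ) - β * G n| ≤ C := by
  have hβ0 : 0 < β := by linarith [hβ.1]
  refine ⟨∑ n ∈ Finset.range d, |(G (n + 1) : ℝ) - β * G n|,
    Finset.sum_nonneg fun _ _ => abs_nonneg _, fun n => ?_⟩
  set C := ∑ n ∈ Finset.range d, |(G (n + 1) : ℝ) - β * G n|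
  induction n using Nat.strong_induction_on with
  | _ n ih =>
    rcases lt_or_ge n d with h | h
    · exact Finset.single_le_sum (f := fun n => |(G (n + 1) : ℝ) - β * G n|)
        (fun _ _ => abs_nonneg _) (Finset.mem_range.2 h)
    · obtain ⟨m, rfl⟩ := Nat.exists_eq_add_of_le' h
      have h1 := abs_add_sub_pow_mul_le (G := G) hβ0.le m d fun t ht => ih (m + t) (by omega)
      have h2 : (G (m + d + 1) : ℝ) + a * G m = (a + 1) * G (m + d) := by
        exact_mod_cast hG.succ_add_mul m
      have h3 : β ^ d * ((G (m + d + 1) : ℝ) - β * G (m + d)) =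
          a * (G (m + d) - β ^ d * G m) := by
        linear_combination β ^ d * h2 - (G (m + d) : ℝ) * hβ.sub_one_mul_pow
      have hpow : 0 < β ^ d := pow_pos hβ0 d
      refine le_of_mul_le_mul_left ?_ hpow
      rw [← abs_of_pos hpow, ← abs_mul, abs_of_pos hpow, h3, abs_mul, Nat.abs_cast]
      calc (a : ℝ) * |(G (m + d) : ℝ) - β ^ d * G m|
          ≤ a * (C * ∑ t ∈ Finset.range d, β ^ t) := by gcongr
        _ = β ^ d * C := by rw [hβ.2]; ring

lemma IsNumSys.pow_le (hG : IsNumSys a d G) (ha : 1 ≤ a) (hd : 1 ≤ d) (hβ : IsCharRoot a d β)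
    (n : ℕ) : β ^ n ≤ β ^ d * G n := by
  induction n using Nat.strong_induction_on with
  | _ n ih =>
    rcases lt_or_ge n d with h | h
    · have h1 : β ^ n ≤ β ^ d := pow_le_pow_right₀ hβ.1.le h.le
      have h2 : (1 : ℝ) ≤ G n := by exact_mod_cast hG.pos ha hd n
      have h3 : 0 ≤ β ^ d := by have := hβ.1; positivity
      nlinarith
    · obtain ⟨m, rfl⟩ := Nat.exists_eq_add_of_le' h
      rw [hG.2.2 m, pow_add]
      nth_rewrite 1 [hβ.2]
      push_cast
      calc β ^ m * (a * ∑ j ∈ Finset.range d, β ^ j)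
          = a * ∑ j ∈ Finset.range d, β ^ (m + j) := by
            simp only [pow_add, ← Finset.mul_sum]; ring
        _ ≤ a * ∑ j ∈ Finset.range d, β ^ d * G (m + j) := by
            gcongr with j hj
            exact ih (m + j) (by have := Finset.mem_range.1 hj; omega)
        _ = β ^ d * (a * ∑ j ∈ Finset.range d, (G (m + j) : ℝ)) := by
            rw [← Finset.mul_sum]; ring

lemma abs_monna_sub_sum_le (hβ : 1 < β) {e : ℕ → ℕ} (he : ∀ k, e k ≤ a) (K : ℕ) :
    |monna β e - ∑ k ∈ Finset.range K, (e k : ℝ) / β ^ (k + 1)| ≤ a / (β - 1) / β ^ K := by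
  have hβ0 : 0 < β := by linarith
  have hgeom : HasSum (fun k : ℕ => (a : ℝ) / β ^ (k + 1)) (a / (β - 1)) := by
    have h := (hasSum_geometric_of_lt_one (inv_nonneg.2 hβ0.le) (inv_lt_one_of_one_lt₀ hβ)).mul_left
      ((a : ℝ) / β)
    have h1 : ∀ k : ℕ, (a : ℝ) / β * β⁻¹ ^ k = a / β ^ (k + 1) := fun k => by
      rw [pow_succ, inv_pow]
      field_simp
    have h2 : (a : ℝ) / β * (1 - β⁻¹)⁻¹ = a / (β - 1) := by
      rw [← div_eq_mul_inv, div_div, mul_sub, mul_one, mul_inv_cancel₀ hβ0.ne']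
    simpa only [h1, h2] using h
  have hs : Summable fun k => (e k : ℝ) / β ^ (k + 1) :=
    Summable.of_nonneg_of_le (fun k => by positivity)
      (fun k => by gcongr; exact he k) hgeom.summable
  rw [monna, ← hs.sum_add_tsum_nat_add K, add_sub_cancel_left,
    abs_of_nonneg (tsum_nonneg fun k => by positivity)]
  refine ((summable_nat_add_iff K).2 hs).tsum_le_of_sum_le fun s => ?_
  have hg := hgeom.div_const (β ^ K)
  refine le_trans (Finset.sum_le_sum fun k _ => ?_) (sum_le_hasSum s (fun k _ => by positivity) hg)
  rw [div_div, ← pow_add, show k + 1 + K = k + K + 1 by omega]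
  gcongr
  exact he _

lemma IsNumSys.exists_revSum_error (hG : IsNumSys a d G) (ha : 1 ≤ a) (hd : 1 ≤ d)
    (hβ : IsCharRoot a d β) :
    ∃ D : ℕ → ℝ, (∀ K, 0 ≤ D K) ∧ Tendsto (fun K => D K / G K) atTop (nhds 0) ∧
      ∀ e : ℕ → ℕ, (∀ k, e k ≤ a) → ∀ K, |G K * monna β e - revSum G K e| ≤ D K := by
  obtain ⟨C, hC0, hC⟩ := hG.exists_abs_succ_sub_le hβ
  have hβ1 := hβ.1
  have hβ0 : 0 < β := by linarith
  have hβs : 0 < β - 1 := by linarith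
  have hGpos : ∀ n, (0 : ℝ) < G n := fun n => by exact_mod_cast hG.pos ha hd n
  refine ⟨fun K => K * (a * (C / (β - 1))) + G K * (a / (β - 1) / β ^ K),
    fun K => by positivity, ?_, fun e he K => ?_⟩
  · have h1 : Tendsto (fun K : ℕ => (K : ℝ) / G K) atTop (nhds 0) := by
      have h := ((tendsto_pow_const_div_const_pow_of_one_lt 1 hβ1).const_mul (β ^ d))
      rw [mul_zero] at h
      refine squeeze_zero (fun K => by have := hGpos K; positivity) (fun K => ?_) h
      have h2 := hG.pow_le ha hd hβ K
      have h3 : 0 < β ^ K := by positivity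
      rw [pow_one, mul_div_assoc', div_le_div_iff₀ (hGpos K) h3]
      nlinarith [Nat.cast_nonneg (α := ℝ) K]
    have h2 : Tendsto (fun K : ℕ => (a : ℝ) / (β - 1) / β ^ K) atTop (nhds 0) :=
      (tendsto_pow_atTop_atTop_of_one_lt hβ1).const_div_atTop _
    have h3 := (h1.mul_const (a * (C / (β - 1)))).add h2
    rw [zero_mul, zero_add] at h3
    refine h3.congr fun K => ?_
    have := (hGpos K).ne'
    field_simp
  · have h1 := abs_monna_sub_sum_le hβ1 he K
    have h2 : |(G K : ℝ) * ∑ k ∈ Finset.range K, (e k : ℝ) / β ^ (k + 1) - revSum G K e| ≤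
        K * (a * (C / (β - 1))) := by
      rw [revSum, Nat.cast_sum, Finset.mul_sum, ← Finset.sum_sub_distrib]
      refine (Finset.abs_sum_le_sum_abs (_ : ℕ → ℝ) _).trans ?_
      have hconst : (K : ℝ) * (a * (C / (β - 1))) =
          ∑ _k ∈ Finset.range K, (a : ℝ) * (C / (β - 1)) := by simp
      rw [hconst]
      refine Finset.sum_le_sum fun k hk => ?_
      have hk := Finset.mem_range.1 hk
      have h3 := abs_add_sub_pow_mul_le (G := G) hβ0.le (K - 1 - k) (k + 1) fun t _ => hC _
      rw [show K - 1 - k + (k + 1) = K by omega] at h3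
      have hp : 0 < β ^ (k + 1) := by positivity
      have h4 : (G K : ℝ) * (e k / β ^ (k + 1)) - (e k * G (K - 1 - k) : ℕ) =
          e k * ((G K - β ^ (k + 1) * G (K - 1 - k)) / β ^ (k + 1)) := by
        push_cast
        field_simp
      rw [h4, abs_mul, Nat.abs_cast, abs_div, abs_of_pos hp]
      have h5 : (e k : ℝ) ≤ a := by exact_mod_cast he k
      refine mul_le_mul h5 ?_ (by positivity) (Nat.cast_nonneg a)
      rw [div_le_div_iff₀ hp hβs]
      calc _ ≤ C * (∑ t ∈ Finset.range (k + 1), β ^ t) * (β - 1) := by gcongr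
        _ = C * (β ^ (k + 1) - 1) := by rw [mul_assoc, geom_sum_mul]
        _ ≤ C * β ^ (k + 1) := by gcongr; linarith
    have h3 : (G K : ℝ) * monna β e - revSum G K e =
        (G K * ∑ k ∈ Finset.range K, (e k : ℝ) / β ^ (k + 1) - revSum G K e) +
        G K * (monna β e - ∑ k ∈ Finset.range K, (e k : ℝ) / β ^ (k + 1)) := by ring
    rw [h3]
    refine (abs_add_le _ _).trans (add_le_add h2 ?_)
    rw [abs_mul, Nat.abs_cast]
    gcongr

lemma abs_card_sub_le {g : ℕ} {x : ℕ → ℝ} {r : ℕ → ℕ} {D v : ℝ} (hD : 0 ≤ D) (hv0 : 0 ≤ v)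
    (hv1 : v ≤ 1) (hr : ∀ n < g, r n < g) (hinj : Set.InjOn r (Finset.range g))
    (hx : ∀ n < g, |g * x n - r n| ≤ D) :
    |∑ n ∈ Finset.range g, ((if x n < v then (1 : ℝ) else 0) - v)| ≤ D + 1 := by
  rw [Finset.sum_sub_distrib, Finset.sum_boole, Finset.sum_const, Finset.card_range, nsmul_eq_mul]
  have hg0 : (0 : ℝ) ≤ g := Nat.cast_nonneg g
  have hmaps : Set.MapsTo r (Finset.range g) (Finset.range g) := fun n hn => by
    simpa using hr n (by simpa using hn)
  have hsurj := Finset.surjOn_of_injOn_of_card_le r hmaps hinj le_rfl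
  rw [abs_le]
  constructor
  · have h1 : ⌈g * v - D⌉₊ ≤ ((Finset.range g).filter fun n => x n < v).card := by
      refine le_trans ?_ (Finset.card_image_le (f := r))
      nth_rewrite 1 [← Finset.card_range ⌈g * v - D⌉₊]
      refine Finset.card_le_card fun k hk => ?_
      have hk := Nat.lt_ceil.1 (Finset.mem_range.1 hk)
      have hkg : k < g := by
        have : (k : ℝ) < g := by nlinarith
        exact_mod_cast this
      obtain ⟨n, hn, rfl⟩ := hsurj (by simpa using hkg : k ∈ (Finset.range g : Set ℕ))
      have hn : n < g := by simpa using hn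
      refine Finset.mem_image.2 ⟨n, Finset.mem_filter.2 ⟨Finset.mem_range.2 hn, ?_⟩, rfl⟩
      have h2 := (abs_le.1 (hx n hn)).2
      have : (g : ℝ) * x n < g * v := by linarith
      exact lt_of_mul_lt_mul_left this hg0
    have h2 := Nat.le_ceil (g * v - D)
    have h3 : (⌈g * v - D⌉₊ : ℝ) ≤ ((Finset.range g).filter fun n => x n < v).card := by
      exact_mod_cast h1
    linarith
  · have h1 : ((Finset.range g).filter fun n => x n < v).card ≤ ⌈g * v + D⌉₊ := by
      rw [← Finset.card_range ⌈g * v + D⌉₊]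
      refine Finset.card_le_card_of_injOn r (fun n hn => ?_) (hinj.mono fun n hn => ?_)
      · obtain ⟨hn, hxv⟩ := Finset.mem_filter.1 (Finset.mem_coe.1 hn)
        have hn := Finset.mem_range.1 hn
        have h2 := (abs_le.1 (hx n hn)).1
        have hg : (0 : ℝ) < g := by exact_mod_cast (by omega : 0 < g)
        have h3 := mul_lt_mul_of_pos_left hxv hg
        refine Finset.mem_coe.2 (Finset.mem_range.2 (Nat.lt_ceil.2 ?_))
        linarith
      · exact (Finset.mem_filter.1 (Finset.mem_coe.1 hn)).1
    have h2 := Nat.ceil_lt_add_one (a := g * v + D) (by positivity)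
    have h3 : (((Finset.range g).filter fun n => x n < v).card : ℝ) ≤ ⌈g * v + D⌉₊ := by
      exact_mod_cast h1
    linarith

end Analysis

section Equidistribution

variable {a d : ℕ} {G : ℕ → ℕ} {β : ℝ}

lemma abs_sum_range_sub_le {e : ℕ → ℕ} {N : ℕ} {f : ℕ → ℝ} {E : ℕ → ℝ}
    (hblock : ∀ j i H, i < e j → H + ∑ k ∈ Finset.range (j + 1), e k * G k = N →
      |∑ n ∈ Finset.range (G j), f (H + i * G j + n)| ≤ E j)
    (j H : ℕ) (hH : H + ∑ k ∈ Finset.range j, e k * G k = N) :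
    |∑ n ∈ Finset.range N, f n - ∑ n ∈ Finset.range H, f n| ≤
      ∑ k ∈ Finset.range j, e k * E k := by
  induction j generalizing H with
  | zero =>
    obtain rfl : H = N := by simpa using hH
    simp
  | succ j ih =>
    have hinner : ∀ i ≤ e j, |∑ n ∈ Finset.range (H + i * G j), f n - ∑ n ∈ Finset.range H, f n| ≤
        i * E j := by
      intro i hi
      induction i with
      | zero => simp
      | succ i ihi =>
        have h1 := ihi (by omega)
        have h2 := hblock j i H hi hH
        rw [show H + (i + 1) * G j = H + i * G j + G j by ring, Finset.sum_range_add,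
          add_sub_right_comm]
        refine (abs_add_le _ _).trans ?_
        push_cast
        linarith
    have h1 := ih (H + e j * G j) (by rw [← hH, Finset.sum_range_succ]; ring)
    have h2 := hinner (e j) le_rfl
    rw [Finset.sum_range_succ]
    refine (abs_sub_le _ (∑ n ∈ Finset.range (H + e j * G j), f n) _).trans ?_
    linarith

lemma tendsto_sum_div (hG : IsNumSys a d G) (ha : 1 ≤ a) (hd : 1 ≤ d) (hβ : IsCharRoot a d β)
    {ε : ℕ → ℕ → ℕ} (hε : ∀ n, IsGExpansion G n (ε n)) {v : ℝ} (hv0 : 0 ≤ v) (hv1 : v ≤ 1) :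
    Tendsto (fun N : ℕ => (∑ n ∈ Finset.range N,
      ((if monna β (ε n) < v then (1 : ℝ) else 0) - v)) / N) atTop (nhds 0) := by
  obtain ⟨D, hD0, hDlim, hD⟩ := hG.exists_revSum_error ha hd hβ
  have hmono := hG.monotone ha hd
  have hadm : ∀ n, IsAdmissible a d (ε n) := fun n => ((hε n).isGreedy hG.1).isAdmissible hG hd
  have hblock : ∀ N j i H, i < ε N j → H + ∑ k ∈ Finset.range (j + 1), ε N k * G k = N →
      |∑ n ∈ Finset.range (G j),
        ((if monna β (ε (H + i * G j + n)) < v then (1 : ℝ) else 0) - v)| ≤ D j + 1 := by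
    intro N j i H hi hH
    have hlow : ∀ n < G j, ∀ k < j, ε (H + i * G j + n) k = ε n k := by
      intro n hn k hk
      obtain ⟨g, hg, hexp⟩ := exists_block_expansion hG.1 hmono (hε N) (hε n) hn hi
      rw [(hε _).unique hG.1 (hexp H hH), hg k hk]
    have hrev : ∀ n < G j, revSum G j (ε (H + i * G j + n)) = revSum G j (ε n) := fun n hn =>
      Finset.sum_congr rfl fun k hk => by rw [hlow n hn k (Finset.mem_range.1 hk)]
    refine abs_card_sub_le (r := fun n => revSum G j (ε n)) (hD0 j) hv0 hv1 (fun n _ => ?_) ?_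
      fun n hn => ?_
    · simp only [revSum_eq]
      exact (hadm n).sum_reverse_lt hG le_rfl
    · intro m hm n hn hmn
      have hm : m < G j := by simpa using hm
      have hn : n < G j := by simpa using hn
      rw [← (hε m).sum_eq_of_lt hmono hm, ← (hε n).sum_eq_of_lt hmono hn]
      refine Finset.sum_congr rfl fun k hk => ?_
      rw [digits_eq_of_revSum_eq hG (hadm m) (hadm n) hmn k (Finset.mem_range.1 hk)]
    · simp only [← hrev n hn]
      exact hD _ (hadm _).1 j
  have hGpos : ∀ n, (0 : ℝ) < G n := fun n => by exact_mod_cast hG.pos ha hd n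
  have hGtop : Tendsto (fun K => (1 : ℝ) / G K) atTop (nhds 0) := by
    have h := (tendsto_pow_atTop_atTop_of_one_lt hβ.1).const_div_atTop (β ^ d)
    refine squeeze_zero (fun K => by have := hGpos K; positivity) (fun K => ?_) h
    have h3 : 0 < β ^ K := pow_pos (by linarith [hβ.1]) K
    rw [div_le_div_iff₀ (hGpos K) h3, one_mul]
    exact hG.pow_le ha hd hβ K
  have hElim := hDlim.add hGtop
  rw [zero_add] at hElim
  rw [Metric.tendsto_atTop]
  intro η hη
  obtain ⟨J, hJ⟩ := eventually_atTop.1 (hElim.eventually_lt_const (half_pos hη))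
  set B := ∑ j ∈ Finset.range J, a * (D j + 1)
  have hbound : ∀ N : ℕ, |∑ n ∈ Finset.range N,
      ((if monna β (ε n) < v then (1 : ℝ) else 0) - v)| ≤ η / 2 * N + B := by
    intro N
    obtain ⟨K₀, hK₀⟩ := (hε N).exists_forall_sum_eq
    have h1 := abs_sum_range_sub_le (G := G) (E := fun j => D j + 1)
      (f := fun n => (if monna β (ε n) < v then (1 : ℝ) else 0) - v) (hblock N) (K₀ + J) 0
      (by rw [zero_add]; exact hK₀ _ (by omega))
    rw [Finset.sum_range_zero, sub_zero] at h1
    refine h1.trans ?_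
    have h2 : ∀ j, (ε N j : ℝ) * (D j + 1) ≤
        η / 2 * (ε N j * G j : ℕ) + if j < J then a * (D j + 1) else 0 := by
      intro j
      have hDj := hD0 j
      have h3 : (ε N j : ℝ) ≤ a := by exact_mod_cast (hadm N).1 j
      split_ifs with hj
      · have h4 : (ε N j : ℝ) * (D j + 1) ≤ a * (D j + 1) := by gcongr
        have h5 : 0 ≤ η / 2 * (ε N j * G j : ℕ) := by positivity
        linarith
      · have h4 := hJ j (by omega)
        rw [← add_div, div_lt_iff₀ (hGpos j)] at h4
        push_cast
        have h5 : (ε N j : ℝ) * (D j + 1) ≤ ε N j * (η / 2 * G j) := by gcongr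
        linarith
    refine (Finset.sum_le_sum fun j _ => h2 j).trans ?_
    rw [Finset.sum_add_distrib, ← Finset.mul_sum, ← Nat.cast_sum, hK₀ _ (by omega),
      ← Finset.sum_filter]
    have h6 : (Finset.range (K₀ + J)).filter (· < J) = Finset.range J := by
      ext j
      simp only [Finset.mem_filter, Finset.mem_range]
      omega
    rw [h6]
  obtain ⟨N₀, hN₀⟩ := exists_nat_gt (B / (η / 2))
  refine ⟨max N₀ 1, fun N hN => ?_⟩
  have hN0 : (0 : ℝ) < N := by exact_mod_cast (by omega : 0 < N)
  rw [dist_zero_right, Real.norm_eq_abs, abs_div, Nat.abs_cast, div_lt_iff₀ hN0]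
  refine (hbound N).trans_lt ?_
  rw [div_lt_iff₀ (half_pos hη)] at hN₀
  have h1 : (N₀ : ℝ) ≤ N := by exact_mod_cast (by omega : N₀ ≤ N)
  have h2 : (N₀ : ℝ) * (η / 2) ≤ N * (η / 2) := by gcongr
  linarith

end Equidistribution

/-- The `β`-adic van der Corput sequence for the numeration system with all
coefficients equal to `a` and order `d` is uniformly distributed in `[0,1)`. -/
theorem vdc_const_coeff_ud (a d : ℕ) (ha : 1 ≤ a) (hd : 1 ≤ d)
    (G : ℕ → ℕ) (hG : IsNumSys a d G)
    (β : ℝ) (hβ : IsCharRoot a d β)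
    (ε : ℕ → ℕ → ℕ) (hε : ∀ n, 1 ≤ n → IsGExpansion G n (ε n)) :
    IsUDOne (fun n => monna β (ε n)) := by
  set ε' : ℕ → ℕ → ℕ := fun n => if n = 0 then 0 else ε n with hε'
  have hexp : ∀ n, IsGExpansion G n (ε' n) := by
    intro n
    rcases Nat.eq_zero_or_pos n with rfl | hn
    · exact ⟨⟨0, by simp [hε'], by simp⟩, fun K _ => by simpa [hε'] using hG.pos ha hd K⟩
    · simpa [hε', hn.ne'] using hε n hn
  intro u v hu huv hv
  have hsub := ((tendsto_sum_div hG ha hd hβ hexp (hu.trans huv) hv).sub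
    (tendsto_sum_div hG ha hd hβ hexp hu (huv.trans hv)))
  set h : ℕ → ℝ := fun n => Set.indicator (Set.Ico u v) (fun _ => (1 : ℝ)) (monna β (ε' n)) with hh
  have hmean : Tendsto (fun N : ℕ => (∑ n ∈ Finset.range N, h n) / N) atTop (nhds (v - u)) := by
    have h1 := hsub.add_const (v - u)
    rw [sub_zero, zero_add] at h1
    refine h1.congr' ?_
    filter_upwards [eventually_gt_atTop 0] with N hN
    have hN0 : (N : ℝ) ≠ 0 := by exact_mod_cast hN.ne'
    have h2 : ∑ n ∈ Finset.range N, h n =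
        ∑ n ∈ Finset.range N, ((if monna β (ε' n) < v then (1 : ℝ) else 0) - v) -
        ∑ n ∈ Finset.range N, ((if monna β (ε' n) < u then (1 : ℝ) else 0) - u) + N * (v - u) := by
      have hconst : (N : ℝ) * (v - u) = ∑ _n ∈ Finset.range N, (v - u) := by
        rw [Finset.sum_const, Finset.card_range, nsmul_eq_mul]
      rw [hconst, ← Finset.sum_sub_distrib, ← Finset.sum_add_distrib]
      refine Finset.sum_congr rfl fun n _ => ?_
      simp only [hh, Set.indicator_apply, Set.mem_Ico]
      split_ifs <;> grind
    rw [h2]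
    field_simp
  have hone : Tendsto (fun N : ℕ => (h N - h 0) / N) atTop (nhds 0) := by
    refine squeeze_zero_norm (a := fun N : ℕ => (1 : ℝ) / N) (fun N => ?_)
      tendsto_one_div_atTop_nhds_zero_nat
    rw [norm_div, Real.norm_natCast, Real.norm_eq_abs]
    gcongr
    simp only [hh, Set.indicator_apply]
    split_ifs <;> norm_num
  have hsum := hmean.add hone
  rw [add_zero] at hsum
  refine hsum.congr fun N => ?_
  have h1 : ∑ n ∈ Finset.Icc 1 N, Set.indicator (Set.Ico u v) (fun _ => (1 : ℝ)) (monna β (ε n)) =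
      ∑ n ∈ Finset.range N, h (n + 1) := by
    rw [Finset.range_eq_Ico, Finset.sum_Ico_add' h 0 N 1]
    refine Finset.sum_congr (by ext; simp) fun n hn => ?_
    have : n ≠ 0 := by have := (Finset.mem_Ico.1 hn).1; omega
    simp [hh, hε', this]
  have h2 := Finset.sum_range_succ h N
  rw [Finset.sum_range_succ'] at h2
  rw [h1, ← add_div]
  congr 1
  linarith
end

section
/- Let b ≥ 1 and d ≥ 1 be integers and let G be the numeration system with all coefficients equal to b and order d. If b' is a positive integer with gcd(b', b) = 1 such that there exists n_0 with b' dividing G_n for all n ≥ n_0, then b' = 1. -/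
open MeasureTheory Filter

/-- If every term after `G n` is divisible by `m`, and `m` is coprime to `b`, then `m ∣ G n`. -/
theorem IsNumSys.dvd_of_forall_lt_dvd {b d : ℕ} {G : ℕ → ℕ} (hG : IsNumSys b d G) (hd : 1 ≤ d)
    {m : ℕ} (hcop : m.Coprime b) {n : ℕ} (h : ∀ k, n < k → m ∣ G k) : m ∣ G n := by
  obtain ⟨e, rfl⟩ := Nat.exists_eq_add_of_le' hd
  have hsum : m ∣ ∑ j ∈ Finset.range (e + 1), G (n + j) :=
    hcop.dvd_of_dvd_mul_left (hG.2.2 n ▸ h (n + (e + 1)) (by omega))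
  rw [Finset.sum_range_succ', add_zero] at hsum
  exact (Nat.dvd_add_right (Finset.dvd_sum fun j _ => h (n + (j + 1)) (by omega))).1 hsum

/-- For the numeration system with all coefficients equal to `b` and order `d`,
if `b'` is a positive integer coprime to `b` which divides `G n` for all
sufficiently large `n`, then `b' = 1`. -/
theorem coprime_eventual_divisor_eq_one (b d : ℕ) (hb : 1 ≤ b) (hd : 1 ≤ d)
    (G : ℕ → ℕ) (hG : IsNumSys b d G)
    (b' : ℕ) (hb' : 1 ≤ b') (hcop : Nat.Coprime b' b)
    (hdvd : ∃ n₀ : ℕ, ∀ n, n₀ ≤ n → b' ∣ G n) :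
    b' = 1 := by
  obtain ⟨n₀, h⟩ := hdvd
  induction n₀ with
  | zero => simpa [hG.1] using h 0 le_rfl
  | succ n ih =>
    refine ih fun k hk => ?_
    rcases hk.eq_or_lt with rfl | hlt
    · exact hG.dvd_of_forall_lt_dvd hd hcop h
    · exact h k hlt
end

section
/- Let b ≥ 1 and d ≥ 1 be integers, let G be the numeration system with all coefficients equal to b and order d, and let β be its characteristic root. Then for every fixed positive integer l, lim_{n→∞} exp(2πi G_n / β^l) = 1; equivalently, the distance from G_n / β^l to the nearest integer tends to 0 as n → ∞. -/
open MeasureTheory Filter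

/-- A sequence annihilated by a linear recurrence whose coefficients `S 1 < ⋯ < S d = 1` are
positive and increasing tends to zero. -/
theorem tendsto_zero_of_sum_strictMono_mul_eq_zero {d : ℕ} (hd : 1 ≤ d) {S D : ℕ → ℝ}
    (h0 : S 0 = 0) (h1 : S d = 1) (hS : StrictMono S)
    (h : ∀ m, ∑ i ∈ Finset.range d, S (i + 1) * D (m + i) = 0) :
    Tendsto D atTop (nhds 0) := by
  have hpos : ∀ i, 0 < S (i + 1) := fun i => h0 ▸ hS (Nat.succ_pos i)
  have shift : ∀ f : ℕ → ℝ, ∑ i ∈ Finset.range d, S (i + 1) * f (i + 1) =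
      ∑ i ∈ Finset.range d, S i * f i + f d := by
    intro f
    have := Finset.sum_range_succ' (fun i => S i * f i) d
    rw [Finset.sum_range_succ] at this
    simpa [h0, h1] using this.symm
  have hw : ∑ i ∈ Finset.range d, (S (i + 1) - S i) = 1 := by
    rw [Finset.sum_range_sub, h0, h1, sub_zero]
  have hmean : ∀ m, ∑ i ∈ Finset.range d, (S (i + 1) - S i) * D (m + i) = D (m + d) := by
    intro m
    have e := shift (fun i => D (m + i))
    have e' := h (m + 1)
    simp only [add_right_comm m 1, add_assoc m _ 1] at e'
    simp only [sub_mul, Finset.sum_sub_distrib, h m]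
    linarith
  -- A weighted energy decreases by the weighted variance of the window at each step.
  let V : ℕ → ℝ := fun m => ∑ i ∈ Finset.range d, S (i + 1) * D (m + i) ^ 2
  have hV : ∀ m, V m - V (m + 1) =
      ∑ i ∈ Finset.range d, (S (i + 1) - S i) * (D (m + i) - D (m + d)) ^ 2 := by
    intro m
    have e := shift (fun i => D (m + i) ^ 2)
    have expand : ∑ i ∈ Finset.range d, (S (i + 1) - S i) * (D (m + i) - D (m + d)) ^ 2 =
        V m - ∑ i ∈ Finset.range d, S i * D (m + i) ^ 2
        - 2 * D (m + d) * ∑ i ∈ Finset.range d, (S (i + 1) - S i) * D (m + i)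
        + D (m + d) ^ 2 * ∑ i ∈ Finset.range d, (S (i + 1) - S i) := by
      simp only [V, Finset.mul_sum, ← Finset.sum_sub_distrib, ← Finset.sum_add_distrib]
      exact Finset.sum_congr rfl fun i _ => by ring
    have eV : V (m + 1) = ∑ i ∈ Finset.range d, S (i + 1) * D (m + (i + 1)) ^ 2 := by
      simp only [V, add_right_comm m 1, add_assoc m _ 1]
    rw [expand, hmean, hw, eV, e]
    ring
  have hterm : ∀ m i, 0 ≤ (S (i + 1) - S i) * (D (m + i) - D (m + d)) ^ 2 := fun m i =>
    mul_nonneg (sub_nonneg.2 (hS.monotone i.le_succ)) (sq_nonneg _)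
  have hanti : Antitone V := antitone_nat_of_succ_le fun m => by
    rw [← sub_nonneg, hV]
    exact Finset.sum_nonneg fun i _ => hterm m i
  have hbdd : BddBelow (Set.range V) := by
    refine ⟨0, ?_⟩
    rintro _ ⟨m, rfl⟩
    exact Finset.sum_nonneg fun i _ => mul_nonneg (hpos i).le (sq_nonneg _)
  have hlim := tendsto_atTop_ciInf hanti hbdd
  have hdiff : Tendsto (fun m => V m - V (m + 1)) atTop (nhds 0) := by
    simpa using hlim.sub ((tendsto_add_atTop_iff_nat 1).2 hlim)
  have hgap : ∀ i ∈ Finset.range d,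
      Tendsto (fun m => D (m + i) - D (m + d)) atTop (nhds 0) := by
    intro i hi
    have hwi : 0 < S (i + 1) - S i := sub_pos.2 (hS i.lt_succ_self)
    have hsq : Tendsto (fun m => (S (i + 1) - S i) * (D (m + i) - D (m + d)) ^ 2) atTop
        (nhds 0) :=
      squeeze_zero (fun m => hterm m i) (fun m => (hV m).symm ▸
        Finset.single_le_sum
          (f := fun i => (S (i + 1) - S i) * (D (m + i) - D (m + d)) ^ 2)
          (fun j _ => hterm m j) hi) hdiff
    have hsq' : Tendsto (fun m => (D (m + i) - D (m + d)) ^ 2) atTop (nhds 0) := by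
      simpa [hwi.ne'] using hsq.const_mul (S (i + 1) - S i)⁻¹
    rw [tendsto_zero_iff_abs_tendsto_zero]
    simpa [Function.comp_def, Real.sqrt_sq_eq_abs] using hsq'.sqrt
  set T := ∑ i ∈ Finset.range d, S (i + 1)
  have hT : 0 < T := Finset.sum_pos (fun i _ => hpos i) (by simpa using by omega)
  have hsum : Tendsto (fun m => ∑ i ∈ Finset.range d, S (i + 1) * (D (m + i) - D (m + d)))
      atTop (nhds 0) := by
    simpa using tendsto_finsetSum (Finset.range d) fun i hi => (hgap i hi).const_mul (S (i + 1))
  refine (tendsto_add_atTop_iff_nat d).1 ?_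
  have key : ∀ m, D (m + d) =
      -T⁻¹ * ∑ i ∈ Finset.range d, S (i + 1) * (D (m + i) - D (m + d)) := by
    intro m
    have hexpand : ∑ i ∈ Finset.range d, S (i + 1) * (D (m + i) - D (m + d)) =
        -(T * D (m + d)) := by
      simp only [mul_sub, Finset.sum_sub_distrib, h m, ← Finset.sum_mul, zero_sub, T]
    rw [hexpand]
    field_simp
  simpa [← key] using hsum.const_mul (-T⁻¹)

theorem IsNumSys.tendsto_succ_sub_mul {b d : ℕ} (hb : 1 ≤ b) (hd : 1 ≤ d) {G : ℕ → ℕ}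
    (hG : IsNumSys b d G) {β : ℝ} (hβ : IsCharRoot b d β) :
    Tendsto (fun n => (G (n + 1) : ℝ) - β * G n) atTop (nhds 0) := by
  obtain ⟨hβ1, hroot⟩ := hβ
  have hβ0 : 0 < β := one_pos.trans hβ1
  have hb0 : (0 : ℝ) < b := by exact_mod_cast hb
  let S : ℕ → ℝ := fun k => b * ∑ j ∈ Finset.range k, (β ^ (j + 1))⁻¹
  have hrec : ∀ k, β * S (k + 1) = b + S k := by
    intro k
    simp only [S]
    rw [Finset.sum_range_succ', mul_left_comm, mul_add, Finset.mul_sum]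
    have : ∀ j, β * (β ^ (j + 1 + 1))⁻¹ = (β ^ (j + 1))⁻¹ := fun j => by
      field_simp
      ring
    simp only [this]
    field_simp
    ring
  have hS0 : S 0 = 0 := by simp [S]
  have hSd : S d = 1 := by
    have e : β ^ d * S d = b * ∑ j ∈ Finset.range d, β ^ j := by
      simp only [S]
      rw [mul_left_comm, Finset.mul_sum, ← Finset.sum_range_reflect (fun j => β ^ j)]
      congr 1
      refine Finset.sum_congr rfl fun j hj => ?_
      have hj' := Finset.mem_range.1 hj
      rw [← div_eq_mul_inv, div_eq_iff (by positivity), ← pow_add]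
      congr 1
      omega
    rw [← hroot] at e
    exact (mul_eq_left₀ (by positivity)).1 e
  have hmono : StrictMono S := strictMono_nat_of_lt_succ fun k => by
    simp only [S]
    rw [Finset.sum_range_succ]
    exact mul_lt_mul_of_pos_left (lt_add_of_pos_right _ (by positivity)) hb0
  refine tendsto_zero_of_sum_strictMono_mul_eq_zero hd hS0 hSd hmono fun m => ?_
  have hGm : (G (m + d) : ℝ) = b * ∑ j ∈ Finset.range d, (G (m + j) : ℝ) := by
    exact_mod_cast hG.2.2 m
  have htel := Finset.sum_range_sub (fun i => S i * (G (m + i) : ℝ)) d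
  rw [hS0, hSd, one_mul, zero_mul, sub_zero, hGm, Finset.mul_sum, ← sub_eq_zero,
    ← Finset.sum_sub_distrib] at htel
  rw [← htel]
  refine Finset.sum_congr rfl fun i _ => ?_
  rw [add_assoc]
  linear_combination (-(G (m + i) : ℝ)) * hrec i

theorem tendsto_add_sub_pow_mul {u : ℕ → ℝ} {β : ℝ}
    (h : Tendsto (fun n => u (n + 1) - β * u n) atTop (nhds 0)) (l : ℕ) :
    Tendsto (fun n => u (n + l) - β ^ l * u n) atTop (nhds 0) := by
  induction l with
  | zero => simp
  | succ l ih =>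
    have := ((tendsto_add_atTop_iff_nat l).2 h).add (ih.const_mul β)
    rw [mul_zero, add_zero] at this
    refine this.congr fun n => ?_
    rw [← add_assoc]
    ring

/-- For the numeration system with all coefficients equal to `b` and order `d`
with characteristic root `β`, and any fixed `l ≥ 1`, one has
`exp(2πi G n / β^l) → 1`; equivalently, the distance from `G n / β^l` to the
nearest integer tends to `0`. -/
theorem exp_Gn_div_pow_tendsto_one (b d : ℕ) (hb : 1 ≤ b) (hd : 1 ≤ d)
    (G : ℕ → ℕ) (hG : IsNumSys b d G)
    (β : ℝ) (hβ : IsCharRoot b d β) (l : ℕ) (hl : 1 ≤ l) :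
    Tendsto (fun n : ℕ =>
        Complex.exp (2 * Real.pi * Complex.I * (G n : ℂ) / (β : ℂ) ^ l))
      atTop (nhds 1) ∧
    Tendsto (fun n : ℕ =>
        |(G n : ℝ) / β ^ l - (round ((G n : ℝ) / β ^ l) : ℝ)|)
      atTop (nhds 0) := by
  have hβ0 : 0 < β := one_pos.trans hβ.1
  have hlim : Tendsto (fun n => (G (n + l) : ℝ) / β ^ l - G n) atTop (nhds 0) := by
    have := (tendsto_add_sub_pow_mul (u := fun n => (G n : ℝ))
      (hG.tendsto_succ_sub_mul hb hd hβ) l).div_const (β ^ l)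
    rw [zero_div] at this
    refine this.congr fun n => ?_
    field_simp
  constructor
  · refine (tendsto_add_atTop_iff_nat l).1 ?_
    have hcont : Continuous fun x : ℝ => Complex.exp (2 * Real.pi * Complex.I * x) := by
      fun_prop
    have := (hcont.tendsto 0).comp hlim
    simp only [Complex.ofReal_zero, mul_zero, Complex.exp_zero] at this
    refine this.congr fun n => ?_
    rw [Function.comp_apply, Complex.exp_eq_exp_iff_exists_int]
    refine ⟨-(G n : ℤ), ?_⟩
    push_cast
    ring
  · refine (tendsto_add_atTop_iff_nat l).1 ?_
    refine squeeze_zero (fun _ => abs_nonneg _) (fun n => ?_)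
      (tendsto_zero_iff_abs_tendsto_zero _ |>.1 hlim)
    exact_mod_cast round_le ((G (n + l) : ℝ) / β ^ l) (G n : ℤ)
end
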